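/- arXiv:2106.02507 — 2 statements merged into one kernel-verified Lean document; each statement's English description precedes it below -/
import Mathlib

section
/- Let n ≥ 1, let λ ∈ (0,1], let a be a measurable coefficient field on B₁ ⊂ ℝⁿ that is uniformly elliptic with constant λ, and let v ∈ C¹(B₁) be a weak subsolution of div(a∇v) = 0 in B₁ which is bounded above. For every δ > 0 there exists ε > 0 depending only on n, λ, and δ such that: if the Lebesgue measure of {x ∈ B₁ : max{v(x),0} = 0} is at least δ·|B₁|, then sup_{B_{1/2}} v ≤ (1−ε)·sup_{B₁} max{v,0}. -/
open MeasureTheory Metric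

noncomputable section

/-- A coefficient field `a` on `U ⊆ ℝⁿ` is uniformly elliptic with constant `lam ∈ (0,1]`. -/
def UniformlyElliptic {n : ℕ} (lam : ℝ) (U : Set (EuclideanSpace ℝ (Fin n)))
    (a : EuclideanSpace ℝ (Fin n) → Matrix (Fin n) (Fin n) ℝ) : Prop :=
  ∀ x ∈ U, (a x).IsSymm ∧
    ∀ ξ : EuclideanSpace ℝ (Fin n),
      lam * ‖ξ‖ ^ 2 ≤ ∑ i, ∑ j, ξ i * a x i j * ξ j ∧
        ∑ i, ∑ j, ξ i * a x i j * ξ j ≤ lam⁻¹ * ‖ξ‖ ^ 2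

/-- `v` is a weak subsolution of `div(a ∇v) = 0` in `U`. -/
def IsWeakSubsolution {n : ℕ} (U : Set (EuclideanSpace ℝ (Fin n)))
    (a : EuclideanSpace ℝ (Fin n) → Matrix (Fin n) (Fin n) ℝ)
    (v : EuclideanSpace ℝ (Fin n) → ℝ) : Prop :=
  ∀ φ : EuclideanSpace ℝ (Fin n) → ℝ,
    ContDiff ℝ 1 φ → HasCompactSupport φ → tsupport φ ⊆ U → (∀ x, 0 ≤ φ x) →
      ∫ x in U, ∑ i, ∑ j, gradient φ x i * a x i j * gradient v x j ≤ 0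

theorem hasDerivAt_max_zero_pow (k : ℕ) (t : ℝ) :
    HasDerivAt (fun t : ℝ => (max t 0) ^ (k + 2)) ((k + 2) * (max t 0) ^ (k + 1)) t := by
  rcases lt_trichotomy t 0 with h | rfl | h
  · have : (fun t : ℝ => (max t 0) ^ (k + 2)) =ᶠ[nhds t] fun _ => 0 := by
      filter_upwards [Iio_mem_nhds h] with s hs
      simp [max_eq_right (Set.mem_Iio.1 hs).le]
    simpa [max_eq_right h.le] using (hasDerivAt_const t (0 : ℝ)).congr_of_eventuallyEq this
  · rw [hasDerivAt_iff_isLittleO_nhds_zero]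
    have h1 : (fun h : ℝ => h ^ (k + 2)) =o[nhds 0] fun h => h := by
      simpa using Asymptotics.isLittleO_pow_pow (𝕜 := ℝ) (show 1 < k + 2 by omega)
    refine (Asymptotics.IsBigO.of_bound 1 (Filter.Eventually.of_forall fun x => ?_)).trans_isLittleO
      h1
    have : |max x 0| ≤ |x| := by
      rw [abs_of_nonneg (le_max_right x 0)]
      exact max_le (le_abs_self x) (abs_nonneg x)
    simpa using pow_le_pow_left₀ (abs_nonneg _) this (k + 2)
  · have : (fun t : ℝ => (max t 0) ^ (k + 2)) =ᶠ[nhds t] fun t => t ^ (k + 2) := by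
      filter_upwards [Ioi_mem_nhds h] with s hs
      simp [max_eq_left (Set.mem_Ioi.1 hs).le]
    rw [max_eq_left h.le]
    simpa [add_assoc, one_add_one_eq_two] using (hasDerivAt_pow (k + 2) t).congr_of_eventuallyEq this

/-- A `C²` convex truncation of `-log (1 - t)`, vanishing for `t ≤ 0`. -/
def truncLog (t : ℝ) : ℝ := -Real.log (1 - (max t 0) ^ 3)

/-- The derivative of `truncLog`. -/
def truncLogDeriv (t : ℝ) : ℝ := 3 * (max t 0) ^ 2 / (1 - (max t 0) ^ 3)

/-- The second derivative of `truncLog`. -/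
def truncLogDeriv₂ (t : ℝ) : ℝ :=
  6 * max t 0 / (1 - (max t 0) ^ 3) + 9 * (max t 0) ^ 4 / (1 - (max t 0) ^ 3) ^ 2

theorem one_sub_max_zero_pow_pos {t : ℝ} (ht : t < 1) : 0 < 1 - (max t 0) ^ 3 := by
  have := pow_lt_one₀ (le_max_right t 0) (max_lt ht one_pos) three_ne_zero
  linarith

theorem truncLog_nonneg {t : ℝ} (ht : t < 1) : 0 ≤ truncLog t := by
  have h := one_sub_max_zero_pow_pos ht
  have h0 : 0 ≤ (max t 0) ^ 3 := by positivity
  have := Real.log_nonpos h.le (by linarith)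
  unfold truncLog; linarith

theorem truncLog_of_nonpos {t : ℝ} (ht : t ≤ 0) : truncLog t = 0 := by
  simp [truncLog, max_eq_right ht]

theorem truncLogDeriv_nonneg {t : ℝ} (ht : t < 1) : 0 ≤ truncLogDeriv t := by
  have h := one_sub_max_zero_pow_pos ht
  unfold truncLogDeriv; positivity

theorem truncLogDeriv_sq_le {t : ℝ} (ht : t < 1) : truncLogDeriv t ^ 2 ≤ truncLogDeriv₂ t := by
  have h := one_sub_max_zero_pow_pos ht
  have : 0 ≤ 6 * max t 0 / (1 - (max t 0) ^ 3) := by positivity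
  have h2 : truncLogDeriv t ^ 2 = 9 * (max t 0) ^ 4 / (1 - (max t 0) ^ 3) ^ 2 := by
    unfold truncLogDeriv; rw [div_pow]; ring
  rw [h2, truncLogDeriv₂]; linarith

theorem hasDerivAt_truncLog {t : ℝ} (ht : t < 1) : HasDerivAt truncLog (truncLogDeriv t) t := by
  have h := one_sub_max_zero_pow_pos ht
  have h3 : HasDerivAt (fun t : ℝ => (max t 0) ^ 3) (3 * (max t 0) ^ 2) t := by
    convert! hasDerivAt_max_zero_pow 1 t using 1; norm_num
  refine (((h3.const_sub 1).log h.ne').neg).congr_deriv ?_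
  rw [truncLogDeriv, neg_div, neg_neg]

theorem hasDerivAt_truncLogDeriv {t : ℝ} (ht : t < 1) :
    HasDerivAt truncLogDeriv (truncLogDeriv₂ t) t := by
  have h := one_sub_max_zero_pow_pos ht
  have h3 : HasDerivAt (fun t : ℝ => (max t 0) ^ 3) (3 * (max t 0) ^ 2) t := by
    convert! hasDerivAt_max_zero_pow 1 t using 1; norm_num
  have h2 : HasDerivAt (fun t : ℝ => (max t 0) ^ 2) (2 * (max t 0)) t := by
    convert! hasDerivAt_max_zero_pow 0 t using 1; norm_num
  refine ((h2.const_mul 3).div (h3.const_sub 1) h.ne').congr_deriv ?_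
  rw [truncLogDeriv₂]
  field_simp
  ring

theorem continuousOn_truncLogDeriv₂ : ContinuousOn truncLogDeriv₂ (Set.Iio 1) := by
  have h : ∀ t ∈ Set.Iio (1 : ℝ), 1 - (max t 0) ^ 3 ≠ 0 := fun t ht =>
    (one_sub_max_zero_pow_pos ht).ne'
  unfold truncLogDeriv₂
  refine ContinuousOn.add (ContinuousOn.div (by fun_prop) (by fun_prop) h)
    (ContinuousOn.div (by fun_prop) (by fun_prop) fun t ht => pow_ne_zero 2 (h t ht))

theorem le_of_truncLog_le {t C : ℝ} (ht : t < 1) (hC : truncLog t ≤ C) :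
    t ≤ 1 - Real.exp (-C) / 3 := by
  have h := one_sub_max_zero_pow_pos ht
  have h1 : Real.exp (-C) ≤ 1 - (max t 0) ^ 3 := by
    rw [← Real.le_log_iff_exp_le h]; unfold truncLog at hC; linarith
  have h0 : 0 ≤ (max t 0) ^ 3 := by positivity
  set e := Real.exp (-C) / 3 with he
  have he0 : 0 < e := by positivity
  have h2 : (max t 0) ^ 3 ≤ (1 - e) ^ 3 := by
    have h3 : 0 ≤ e ^ 2 * (3 - e) := mul_nonneg (sq_nonneg e) (by linarith)
    nlinarith
  exact (le_max_left t 0).trans (le_of_pow_le_pow_left₀ three_ne_zero (by linarith) h2)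

section Elliptic

variable {n : ℕ} {lam : ℝ} {A : Matrix (Fin n) (Fin n) ℝ}

theorem sum_sum_mul_eq_dotProduct (ξ η : EuclideanSpace ℝ (Fin n)) :
    ∑ i, ∑ j, ξ i * A i j * η j = dotProduct ξ.ofLp (A.mulVec η.ofLp) := by
  simp only [dotProduct, Matrix.mulVec, Finset.mul_sum, mul_assoc]

theorem quadForm_linComb (hA : A.IsSymm) (s t : ℝ) (ξ η : EuclideanSpace ℝ (Fin n)) :
    ∑ i, ∑ j, (s • ξ + t • η) i * A i j * (s • ξ + t • η) j =
      s ^ 2 * (∑ i, ∑ j, ξ i * A i j * ξ j) + 2 * s * t * (∑ i, ∑ j, η i * A i j * ξ j) +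
        t ^ 2 * (∑ i, ∑ j, η i * A i j * η j) := by
  have hs : dotProduct ξ.ofLp (A.mulVec η.ofLp) = dotProduct η.ofLp (A.mulVec ξ.ofLp) := by
    rw [Matrix.dotProduct_mulVec, ← Matrix.mulVec_transpose, hA.eq, dotProduct_comm]
  simp only [sum_sum_mul_eq_dotProduct]
  simp only [WithLp.ofLp_add, WithLp.ofLp_smul, Matrix.mulVec_add,
    Matrix.mulVec_smul, dotProduct_add, add_dotProduct, smul_dotProduct, dotProduct_smul, hs,
    smul_eq_mul]
  ring

theorem form_linComb_left (s t : ℝ) (ξ η : EuclideanSpace ℝ (Fin n)) :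
    ∑ i, ∑ j, (s • ξ + t • η) i * A i j * ξ j =
      s * (∑ i, ∑ j, ξ i * A i j * ξ j) + t * (∑ i, ∑ j, η i * A i j * ξ j) := by
  simp only [sum_sum_mul_eq_dotProduct]
  simp only [WithLp.ofLp_add, WithLp.ofLp_smul, add_dotProduct,
    smul_dotProduct, smul_eq_mul]

theorem abs_entry_le (hA : A.IsSymm)
    (h : ∀ ξ : EuclideanSpace ℝ (Fin n), lam * ‖ξ‖ ^ 2 ≤ ∑ i, ∑ j, ξ i * A i j * ξ j ∧
        ∑ i, ∑ j, ξ i * A i j * ξ j ≤ lam⁻¹ * ‖ξ‖ ^ 2) (hlam : 0 < lam) (i j : Fin n) :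
    |A i j| ≤ lam⁻¹ := by
  have key : ∀ k l : Fin n, ∑ i, ∑ j, (EuclideanSpace.single k (1 : ℝ)) i * A i j *
      (EuclideanSpace.single l (1 : ℝ)) j = A k l := by
    intro k l
    simp [PiLp.single_apply]
  have hu : ∀ k, A k k ≤ lam⁻¹ := fun k => by
    simpa [key] using (h (EuclideanSpace.single k 1)).2
  have hp := quadForm_linComb hA 1 1 (EuclideanSpace.single i 1) (EuclideanSpace.single j 1)
  have hm := quadForm_linComb hA 1 (-1) (EuclideanSpace.single i 1) (EuclideanSpace.single j 1)
  have hp' := (h ((1 : ℝ) • EuclideanSpace.single i 1 + (1 : ℝ) • EuclideanSpace.single j 1)).1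
  have hm' := (h ((1 : ℝ) • EuclideanSpace.single i 1 + (-1 : ℝ) • EuclideanSpace.single j 1)).1
  rw [hp] at hp'
  rw [hm] at hm'
  simp only [key] at hp' hm'
  have hp0 : 0 ≤ lam * ‖(1 : ℝ) • EuclideanSpace.single i (1 : ℝ) +
    (1 : ℝ) • EuclideanSpace.single j 1‖ ^ 2 := by positivity
  have hm0 : 0 ≤ lam * ‖(1 : ℝ) • EuclideanSpace.single i (1 : ℝ) +
    (-1 : ℝ) • EuclideanSpace.single j 1‖ ^ 2 := by positivity
  have hij : A j i = A i j := hA.apply i j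
  rw [hij] at hp' hm'
  rw [abs_le]
  constructor <;> nlinarith [hu i, hu j]

theorem caccioppoli_pointwise (hA : A.IsSymm)
    (h : ∀ ξ : EuclideanSpace ℝ (Fin n), lam * ‖ξ‖ ^ 2 ≤ ∑ i, ∑ j, ξ i * A i j * ξ j ∧
        ∑ i, ∑ j, ξ i * A i j * ξ j ≤ lam⁻¹ * ‖ξ‖ ^ 2) (hlam : 0 < lam)
    (ξ η : EuclideanSpace ℝ (Fin n)) {p y dy z : ℝ} (hdy : 0 ≤ dy) (hz : 0 ≤ z)
    (hy : y ^ 2 ≤ dy * z) :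
    lam / 2 * (p ^ 2 * dy * ‖ξ‖ ^ 2) - 2 * lam⁻¹ * (z * ‖η‖ ^ 2) ≤
      ∑ i, ∑ j, ((p ^ 2 * dy) • ξ + (2 * p * y) • η) i * A i j * ξ j := by
  rw [form_linComb_left]
  have hq := quadForm_linComb hA (p * dy) (2 * y) ξ η
  have hq' := (h ((p * dy) • ξ + (2 * y) • η)).1
  rw [hq] at hq'
  have hq0 : 0 ≤ lam * ‖(p * dy) • ξ + (2 * y) • η‖ ^ 2 := by positivity
  obtain ⟨h1, -⟩ := h ξ
  obtain ⟨h3, h4⟩ := h η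
  have h30 : 0 ≤ lam * ‖η‖ ^ 2 := by positivity
  set Q := ∑ i, ∑ j, ξ i * A i j * ξ j
  set R := ∑ i, ∑ j, η i * A i j * ξ j
  set S := ∑ i, ∑ j, η i * A i j * η j
  have hzS : z * S ≤ z * (lam⁻¹ * ‖η‖ ^ 2) := mul_le_mul_of_nonneg_left h4 hz
  have hQ : p ^ 2 * dy * (lam * ‖ξ‖ ^ 2) ≤ p ^ 2 * dy * Q :=
    mul_le_mul_of_nonneg_left h1 (by positivity)
  rcases hdy.eq_or_lt with h0 | hpos
  · subst h0
    have : y = 0 := by nlinarith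
    subst this
    have : 0 ≤ z * (lam⁻¹ * ‖η‖ ^ 2) := by positivity
    nlinarith
  · have hS : y ^ 2 * S ≤ dy * z * S := mul_le_mul_of_nonneg_right hy (by linarith)
    have : 0 ≤ dy * (p ^ 2 * dy * Q + 4 * p * y * R + 4 * z * S) := by nlinarith
    have := nonneg_of_mul_nonneg_right this hpos
    nlinarith

end Elliptic

section Localization

variable {E : Type*} [NormedAddCommGroup E] {U : Set E} {φ w : E → ℝ}

theorem continuous_mul_of_tsupport_subset (hφ : Continuous φ) (hw : ContinuousOn w U)
    (hU : IsOpen U) (hs : tsupport φ ⊆ U) : Continuous fun x => φ x * w x :=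
  continuous_of_tsupport fun _ hx => hφ.continuousAt.mul
    (hw.continuousAt (hU.mem_nhds (hs (tsupport_mul_subset_left hx))))

theorem integrable_mul_of_tsupport_subset [MeasurableSpace E] [BorelSpace E] {μ : Measure E}
    [IsFiniteMeasureOnCompacts μ] (hφ : Continuous φ) (hφc : HasCompactSupport φ)
    (hw : ContinuousOn w U) (hU : IsOpen U) (hs : tsupport φ ⊆ U) :
    Integrable (fun x => φ x * w x) μ :=
  (continuous_mul_of_tsupport_subset hφ hw hU hs).integrable_of_hasCompactSupport hφc.mul_right

theorem contDiff_mul_of_tsupport_subset [NormedSpace ℝ E] (hφ : ContDiff ℝ 1 φ)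
    (hw : ContDiffOn ℝ 1 w U) (hU : IsOpen U) (hs : tsupport φ ⊆ U) :
    ContDiff ℝ 1 fun x => φ x * w x := by
  rw [contDiff_iff_contDiffAt]
  intro x
  by_cases hx : x ∈ tsupport φ
  · exact hφ.contDiffAt.mul (hw.contDiffAt (hU.mem_nhds (hs hx)))
  · refine (contDiffAt_const (c := (0 : ℝ))).congr_of_eventuallyEq ?_
    filter_upwards [notMem_tsupport_iff_eventuallyEq.1 hx] with y hy
    simp [hy]

end Localization

section Gradient

variable {E : Type*} [NormedAddCommGroup E] [InnerProductSpace ℝ E] [CompleteSpace E]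

theorem norm_gradient_eq (f : E → ℝ) (x : E) : ‖gradient f x‖ = ‖fderiv ℝ f x‖ := by
  rw [← toDual_gradient, LinearIsometryEquiv.norm_map]

theorem continuousOn_gradient {f : E → ℝ} {U : Set E} (hf : ContDiffOn ℝ 1 f U)
    (hU : IsOpen U) : ContinuousOn (gradient f) U :=
  (InnerProductSpace.toDual ℝ E).symm.continuous.comp_continuousOn
    (hf.continuousOn_fderiv_of_isOpen hU le_rfl)

theorem gradient_eq_zero_of_notMem_tsupport {f : E → ℝ} {x : E} (hx : x ∉ tsupport f) :
    gradient f x = 0 := by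
  have : fderiv ℝ f x = 0 := by
    by_contra h
    exact hx (support_fderiv_subset ℝ h)
  rw [gradient, this, map_zero]

theorem gradient_sq_mul {f g : E → ℝ} {x ξ η : E} {d : ℝ} {Y : ℝ → ℝ}
    (hf : HasGradientAt f η x) (hg : HasGradientAt g ξ x) (hY : HasDerivAt Y d (g x)) :
    gradient (fun z => f z ^ 2 * Y (g z)) x =
      (f x ^ 2 * d) • ξ + (2 * f x * Y (g x)) • η := by
  apply HasGradientAt.gradient
  rw [hasGradientAt_iff_hasFDerivAt] at *
  refine ((hf.pow 2).mul (hY.comp_hasFDerivAt x hg)).congr_fderiv ?_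
  ext z
  simp
  ring

end Gradient

theorem contDiffOn_one_of_hasDerivAt {Y dY : ℝ → ℝ} {s : Set ℝ} (hs : IsOpen s)
    (hY : ∀ t ∈ s, HasDerivAt Y (dY t) t) (hdY : ContinuousOn dY s) : ContDiffOn ℝ 1 Y s := by
  rw [contDiffOn_one_iff_derivWithin hs.uniqueDiffOn]
  refine ⟨fun t ht => (hY t ht).differentiableAt.differentiableWithinAt, ?_⟩
  exact hdY.congr fun t ht => (hY t ht).hasDerivWithinAt.derivWithin (hs.uniqueDiffOn t ht)

section Caccioppoli

variable {n : ℕ} {lam : ℝ} {a : EuclideanSpace ℝ (Fin n) → Matrix (Fin n) (Fin n) ℝ}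
  {v φ : EuclideanSpace ℝ (Fin n) → ℝ} {U : Set (EuclideanSpace ℝ (Fin n))}

theorem integrableOn_form (hlam : 0 < lam) (ham : ∀ i j, Measurable fun x => a x i j)
    (hell : UniformlyElliptic lam U a) (hU : IsOpen U) (hv : ContDiffOn ℝ 1 v U)
    (hφ : ContDiff ℝ 1 φ) (hφc : HasCompactSupport φ) (hφs : tsupport φ ⊆ U) :
    IntegrableOn (fun x => ∑ i, ∑ j, gradient φ x i * a x i j * gradient v x j) U := by
  refine integrable_finsetSum _ fun i _ => integrable_finsetSum _ fun j _ => ?_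
  have hgφ : Continuous fun x => gradient φ x i := by
    have := (continuousOn_gradient hφ.contDiffOn isOpen_univ).comp_continuous continuous_id
      fun x => Set.mem_univ x
    exact (EuclideanSpace.proj (𝕜 := ℝ) i).continuous.comp this
  have hgs : tsupport (fun x => gradient φ x i) ⊆ tsupport φ := by
    refine closure_minimal (fun x hx => ?_) (isClosed_tsupport φ)
    by_contra h
    exact hx (by simp [gradient_eq_zero_of_notMem_tsupport h])
  have hgv : ContinuousOn (fun x => gradient v x j) U :=
    (EuclideanSpace.proj (𝕜 := ℝ) j).continuous.comp_continuousOn (continuousOn_gradient hv hU)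
  have hI := integrable_mul_of_tsupport_subset (μ := volume) hgφ
    (hφc.of_isClosed_subset (isClosed_tsupport _) hgs) hgv hU (hgs.trans hφs)
  have := (hI.integrableOn (s := U)).bdd_mul (f := fun x => a x i j) (c := lam⁻¹)
    (ham i j).aestronglyMeasurable (by
      filter_upwards [ae_restrict_mem hU.measurableSet] with x hx
      exact abs_entry_le (hell x hx).1 (hell x hx).2 hlam i j)
  refine this.congr (Filter.Eventually.of_forall fun x => ?_)
  simp only
  ring

/-- The weighted energy inequality for subsolutions, obtained from the test function
`φ² Y(v)`, where `Y² ≤ dY · Z` and `W ≤ dY`. -/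
theorem caccioppoli (hlam : 0 < lam) (ham : ∀ i j, Measurable fun x => a x i j)
    (hell : UniformlyElliptic lam U a) (hU : IsOpen U) (hv : ContDiffOn ℝ 1 v U)
    (hsub : IsWeakSubsolution U a v) (hv1 : ∀ x ∈ U, v x < 1) {Y dY W Z : ℝ → ℝ}
    (hY : ∀ t < 1, HasDerivAt Y (dY t) t) (hdYc : ContinuousOn dY (Set.Iio 1))
    (hWc : ContinuousOn W (Set.Iio 1)) (hW : ∀ t < 1, W t ≤ dY t)
    (hZc : ContinuousOn Z (Set.Iio 1)) (hY0 : ∀ t < 1, 0 ≤ Y t) (hdY0 : ∀ t < 1, 0 ≤ dY t)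
    (hZ0 : ∀ t < 1, 0 ≤ Z t) (hYZ : ∀ t < 1, Y t ^ 2 ≤ dY t * Z t)
    (hφ : ContDiff ℝ 1 φ) (hφc : HasCompactSupport φ) (hφs : tsupport φ ⊆ U) :
    ∫ x in U, φ x ^ 2 * (W (v x) * ‖fderiv ℝ v x‖ ^ 2) ≤
      4 * lam⁻¹ ^ 2 * ∫ x in U, ‖fderiv ℝ φ x‖ ^ 2 * Z (v x) := by
  have hsq : tsupport (fun x => φ x ^ 2) ⊆ tsupport φ := by
    simp only [sq]; exact tsupport_mul_subset_left
  have hYd : ContDiffOn ℝ 1 Y (Set.Iio 1) := contDiffOn_one_of_hasDerivAt isOpen_Iio hY hdYc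
  have hψ : ContDiff ℝ 1 fun x => φ x ^ 2 * Y (v x) :=
    contDiff_mul_of_tsupport_subset (hφ.pow 2) (hYd.comp hv hv1) hU (hsq.trans hφs)
  have hψt : tsupport (fun x => φ x ^ 2 * Y (v x)) ⊆ tsupport φ :=
    tsupport_mul_subset_left.trans hsq
  have hψc : HasCompactSupport fun x => φ x ^ 2 * Y (v x) :=
    hφc.of_isClosed_subset (isClosed_tsupport _) hψt
  have hψ0 : ∀ x, 0 ≤ φ x ^ 2 * Y (v x) := fun x => by
    by_cases hx : x ∈ U
    · exact mul_nonneg (sq_nonneg _) (hY0 _ (hv1 x hx))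
    · simp [image_eq_zero_of_notMem_tsupport fun h => hx (hφs h)]
  have htest := hsub _ hψ hψc (hψt.trans hφs) hψ0
  have hint := integrableOn_form hlam ham hell hU hv hψ hψc (hψt.trans hφs)
  have hvc : ContinuousOn (fun x => fderiv ℝ v x) U := hv.continuousOn_fderiv_of_isOpen hU le_rfl
  have hI1 : IntegrableOn (fun x => φ x ^ 2 * (W (v x) * ‖fderiv ℝ v x‖ ^ 2)) U :=
    (integrable_mul_of_tsupport_subset (hφ.continuous.pow 2)
      (hφc.of_isClosed_subset (isClosed_tsupport _) hsq)
      ((hWc.comp hv.continuousOn hv1).mul (hvc.norm.pow 2)) hU (hsq.trans hφs)).integrableOn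
  have hdt : tsupport (fun x => ‖fderiv ℝ φ x‖ ^ 2) ⊆ tsupport φ := by
    refine closure_minimal (fun x hx => ?_) (isClosed_tsupport φ)
    exact support_fderiv_subset ℝ (f := φ) fun h => hx (by simp [h])
  have hI2 : IntegrableOn (fun x => ‖fderiv ℝ φ x‖ ^ 2 * Z (v x)) U :=
    (integrable_mul_of_tsupport_subset ((hφ.continuous_fderiv one_ne_zero).norm.pow 2)
      (hφc.of_isClosed_subset (isClosed_tsupport _) hdt)
      (hZc.comp hv.continuousOn hv1) hU (hdt.trans hφs)).integrableOn
  have hmono : ∫ x in U, (lam / 2 * (φ x ^ 2 * (W (v x) * ‖fderiv ℝ v x‖ ^ 2)) -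
      2 * lam⁻¹ * (‖fderiv ℝ φ x‖ ^ 2 * Z (v x))) ≤
      ∫ x in U, ∑ i, ∑ j, gradient (fun x => φ x ^ 2 * Y (v x)) x i * a x i j *
        gradient v x j := by
    refine setIntegral_mono_on ((hI1.const_mul _).sub (hI2.const_mul _)) hint hU.measurableSet
      fun x hx => ?_
    have ht := hv1 x hx
    have hvx : HasGradientAt v (gradient v x) x :=
      ((hv.differentiableOn one_ne_zero).differentiableAt (hU.mem_nhds hx)).hasGradientAt
    have hφx : HasGradientAt φ (gradient φ x) x :=
      (hφ.differentiable one_ne_zero x).hasGradientAt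
    rw [gradient_sq_mul hφx hvx (hY _ ht)]
    have := caccioppoli_pointwise (hell x hx).1 (hell x hx).2 hlam (gradient v x) (gradient φ x)
      (p := φ x) (hdY0 _ ht) (hZ0 _ ht) (hYZ _ ht)
    rw [norm_gradient_eq, norm_gradient_eq] at this
    have hWx : φ x ^ 2 * (W (v x) * ‖fderiv ℝ v x‖ ^ 2) ≤
        φ x ^ 2 * dY (v x) * ‖fderiv ℝ v x‖ ^ 2 := by
      rw [mul_assoc]
      gcongr
      exact hW _ ht
    have := mul_le_mul_of_nonneg_left hWx (half_pos hlam).le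
    linarith
  rw [integral_sub (hI1.const_mul _) (hI2.const_mul _), integral_const_mul,
    integral_const_mul] at hmono
  have h := hmono.trans htest
  set I := ∫ x in U, φ x ^ 2 * (W (v x) * ‖fderiv ℝ v x‖ ^ 2)
  set J := ∫ x in U, ‖fderiv ℝ φ x‖ ^ 2 * Z (v x)
  have : lam / 2 * I ≤ 2 * lam⁻¹ * J := by linarith
  have h2 := mul_le_mul_of_nonneg_left this (show 0 ≤ 2 * lam⁻¹ by positivity)
  calc I = 2 * lam⁻¹ * (lam / 2 * I) := by field_simp
    _ ≤ _ := h2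
    _ = _ := by ring

end Caccioppoli

section TruncLogEnergy

variable {n : ℕ} {lam : ℝ} {a : EuclideanSpace ℝ (Fin n) → Matrix (Fin n) (Fin n) ℝ}
  {v φ : EuclideanSpace ℝ (Fin n) → ℝ} {U : Set (EuclideanSpace ℝ (Fin n))}

theorem continuousOn_truncLog : ContinuousOn truncLog (Set.Iio 1) := fun _ ht =>
  (hasDerivAt_truncLog ht).continuousAt.continuousWithinAt

theorem continuousOn_truncLogDeriv : ContinuousOn truncLogDeriv (Set.Iio 1) := fun _ ht =>
  (hasDerivAt_truncLogDeriv ht).continuousAt.continuousWithinAt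

theorem contDiffOn_truncLog_comp (hv : ContDiffOn ℝ 1 v U) (hv1 : ∀ x ∈ U, v x < 1) :
    ContDiffOn ℝ 1 (fun x => truncLog (v x)) U :=
  (contDiffOn_one_of_hasDerivAt isOpen_Iio (fun _ => hasDerivAt_truncLog)
    continuousOn_truncLogDeriv).comp hv hv1

theorem norm_fderiv_truncLog_comp (hU : IsOpen U) (hv : ContDiffOn ℝ 1 v U)
    (hv1 : ∀ x ∈ U, v x < 1) {x : EuclideanSpace ℝ (Fin n)} (hx : x ∈ U) :
    ‖fderiv ℝ (fun x => truncLog (v x)) x‖ ^ 2 =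
      truncLogDeriv (v x) ^ 2 * ‖fderiv ℝ v x‖ ^ 2 := by
  have hvx := ((hv.differentiableOn one_ne_zero).differentiableAt (hU.mem_nhds hx)).hasFDerivAt
  have := ((hasDerivAt_truncLog (hv1 x hx)).comp_hasFDerivAt x hvx).fderiv
  rw [show (fun x => truncLog (v x)) = truncLog ∘ v from rfl, this, norm_smul, mul_pow,
    Real.norm_eq_abs, sq_abs]

/-- The logarithmic energy bound: its right-hand side does not involve the subsolution. -/
theorem truncLog_energy (hlam : 0 < lam) (ham : ∀ i j, Measurable fun x => a x i j)
    (hell : UniformlyElliptic lam U a) (hU : IsOpen U) (hv : ContDiffOn ℝ 1 v U)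
    (hsub : IsWeakSubsolution U a v) (hv1 : ∀ x ∈ U, v x < 1)
    (hφ : ContDiff ℝ 1 φ) (hφc : HasCompactSupport φ) (hφs : tsupport φ ⊆ U) :
    ∫ x in U, φ x ^ 2 * ‖fderiv ℝ (fun x => truncLog (v x)) x‖ ^ 2 ≤
      4 * lam⁻¹ ^ 2 * ∫ x in U, ‖fderiv ℝ φ x‖ ^ 2 := by
  have := caccioppoli hlam ham hell hU hv hsub hv1 (Y := truncLogDeriv) (dY := truncLogDeriv₂)
    (W := fun t => truncLogDeriv t ^ 2) (Z := fun _ => 1) (fun _ => hasDerivAt_truncLogDeriv)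
    continuousOn_truncLogDeriv₂ (continuousOn_truncLogDeriv.pow 2)
    (fun _ => truncLogDeriv_sq_le) continuousOn_const (fun _ => truncLogDeriv_nonneg)
    (fun t ht => (sq_nonneg _).trans (truncLogDeriv_sq_le ht)) (fun _ _ => zero_le_one)
    (fun t ht => by simpa using truncLogDeriv_sq_le ht) hφ hφc hφs
  simp only [mul_one] at this
  refine le_trans (le_of_eq ?_) this
  refine setIntegral_congr_fun hU.measurableSet fun x hx => ?_
  simp only [norm_fderiv_truncLog_comp hU hv hv1 hx]

theorem truncLog_rpow_energy (hlam : 0 < lam) (ham : ∀ i j, Measurable fun x => a x i j)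
    (hell : UniformlyElliptic lam U a) (hU : IsOpen U) (hv : ContDiffOn ℝ 1 v U)
    (hsub : IsWeakSubsolution U a v) (hv1 : ∀ x ∈ U, v x < 1) {q : ℝ} (hq : 1 ≤ q)
    (hφ : ContDiff ℝ 1 φ) (hφc : HasCompactSupport φ) (hφs : tsupport φ ⊆ U) :
    ∫ x in U, φ x ^ 2 * (q ^ 2 * truncLog (v x) ^ (2 * q - 2) *
        ‖fderiv ℝ (fun x => truncLog (v x)) x‖ ^ 2) ≤
      4 * lam⁻¹ ^ 2 * ∫ x in U, ‖fderiv ℝ φ x‖ ^ 2 * truncLog (v x) ^ (2 * q) := by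
  have h2 : ∀ t < 1, 0 ≤ truncLogDeriv₂ t := fun t ht =>
    (sq_nonneg _).trans (truncLogDeriv_sq_le ht)
  have hr : ∀ {p : ℝ}, ∀ t < 1, 0 ≤ truncLog t ^ p := fun t ht =>
    Real.rpow_nonneg (truncLog_nonneg ht) _
  have hrc : ∀ {p : ℝ}, 0 ≤ p → ContinuousOn (fun t => truncLog t ^ p) (Set.Iio 1) :=
    fun hp => continuousOn_truncLog.rpow_const fun _ _ => Or.inr hp
  have := caccioppoli hlam ham hell hU hv hsub hv1
    (Y := fun t => (2 * q - 1) * truncLog t ^ (2 * q - 1) * truncLogDeriv t)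
    (dY := fun t => (2 * q - 1) ^ 2 * truncLog t ^ (2 * q - 2) * truncLogDeriv t ^ 2 +
      (2 * q - 1) * truncLog t ^ (2 * q - 1) * truncLogDeriv₂ t)
    (W := fun t => q ^ 2 * truncLog t ^ (2 * q - 2) * truncLogDeriv t ^ 2)
    (Z := fun t => truncLog t ^ (2 * q)) ?_ ?_ ?_ ?_ (hrc (by linarith)) ?_ ?_ (fun t ht => hr t ht)
    ?_ hφ hφc hφs
  · refine le_trans (le_of_eq ?_) this
    refine setIntegral_congr_fun hU.measurableSet fun x hx => ?_
    simp only [norm_fderiv_truncLog_comp hU hv hv1 hx]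
    ring
  · intro t ht
    have h := (hasDerivAt_truncLog ht).rpow_const (p := 2 * q - 1) (Or.inr (by linarith))
    refine ((h.const_mul (2 * q - 1)).mul (hasDerivAt_truncLogDeriv ht)).congr_deriv ?_
    rw [show 2 * q - 1 - 1 = 2 * q - 2 by ring]
    ring
  · exact ((continuousOn_const.mul (hrc (by linarith))).mul (continuousOn_truncLogDeriv.pow 2)).add
      ((continuousOn_const.mul (hrc (by linarith))).mul continuousOn_truncLogDeriv₂)
  · exact (continuousOn_const.mul (hrc (by linarith))).mul (continuousOn_truncLogDeriv.pow 2)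
  · intro t ht
    have h1 : q ^ 2 * truncLog t ^ (2 * q - 2) * truncLogDeriv t ^ 2 ≤
        (2 * q - 1) ^ 2 * truncLog t ^ (2 * q - 2) * truncLogDeriv t ^ 2 := by
      have := hr (p := 2 * q - 2) t ht
      gcongr
      linarith
    have h3 : 0 ≤ (2 * q - 1) * truncLog t ^ (2 * q - 1) * truncLogDeriv₂ t :=
      mul_nonneg (mul_nonneg (by linarith) (hr t ht)) (h2 t ht)
    linarith
  · exact fun t ht => mul_nonneg (mul_nonneg (by linarith) (hr t ht)) (truncLogDeriv_nonneg ht)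
  · exact fun t ht => add_nonneg (mul_nonneg (mul_nonneg (sq_nonneg _) (hr t ht)) (sq_nonneg _))
      (mul_nonneg (mul_nonneg (by linarith) (hr t ht)) (h2 t ht))
  · intro t ht
    have h3 : 0 ≤ (2 * q - 1) * truncLog t ^ (2 * q - 1) * truncLogDeriv₂ t :=
      mul_nonneg (mul_nonneg (by linarith) (hr t ht)) (h2 t ht)
    have h4 : (truncLog t ^ (2 * q - 1)) ^ 2 = truncLog t ^ (2 * q - 2) * truncLog t ^ (2 * q) := by
      rw [sq, ← Real.rpow_add_of_nonneg (truncLog_nonneg ht) (by linarith) (by linarith),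
        ← Real.rpow_add_of_nonneg (truncLog_nonneg ht) (by linarith) (by linarith)]
      ring_nf
    have h5 := mul_nonneg h3 (hr (p := 2 * q) t ht)
    calc ((2 * q - 1) * truncLog t ^ (2 * q - 1) * truncLogDeriv t) ^ 2
        = (2 * q - 1) ^ 2 * (truncLog t ^ (2 * q - 1)) ^ 2 * truncLogDeriv t ^ 2 := by ring
      _ ≤ _ := by rw [h4]; linarith

end TruncLogEnergy

section Sobolev

theorem enorm_le_lintegral_enorm_fderiv_of_fin_one {u : EuclideanSpace ℝ (Fin 1) → ℝ}
    (hu : ContDiff ℝ 1 u) (huc : HasCompactSupport u) (x : EuclideanSpace ℝ (Fin 1)) :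
    ‖u x‖ₑ ≤ ∫⁻ y, ‖fderiv ℝ u y‖ₑ := by
  set L := (OrthonormalBasis.singleton (Fin 1) ℝ).repr
  have hg : ContDiff ℝ 1 (u ∘ L) := hu.comp L.contDiff
  have hgc : HasCompactSupport (u ∘ L) :=
    huc.comp_isClosedEmbedding L.toHomeomorph.isClosedEmbedding
  have hd : ∀ s, ‖deriv (u ∘ L) s‖ₑ ≤ ‖fderiv ℝ u (L s)‖ₑ := by
    intro s
    have hL : HasDerivAt L (L 1) s := by
      simpa using L.toContinuousLinearEquiv.hasFDerivAt.hasDerivAt (x := s)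
    rw [((hu.differentiable one_ne_zero (L s)).hasFDerivAt.comp_hasDerivAt s hL).deriv]
    rw [enorm_le_iff_norm_le]
    have h1 : ‖L 1‖ = 1 := (L.norm_map 1).trans norm_one
    exact ((fderiv ℝ u (L s)).le_opNorm (L 1)).trans_eq (by rw [h1, mul_one])
  calc ‖u x‖ₑ = ‖(u ∘ L) (L.symm x)‖ₑ := by simp
    _ ≤ ∫⁻ s in Set.Iic (L.symm x), ‖deriv (u ∘ L) s‖ₑ := hgc.enorm_le_lintegral_Ici_deriv hg _
    _ ≤ ∫⁻ s, ‖deriv (u ∘ L) s‖ₑ := setLIntegral_le_lintegral _ _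
    _ ≤ ∫⁻ s, ‖fderiv ℝ u (L s)‖ₑ := lintegral_mono hd
    _ = ∫⁻ y, ‖fderiv ℝ u y‖ₑ :=
      L.measurePreserving.lintegral_comp (measurable_fderiv ℝ u).enorm

/-- A form of the Sobolev inequality in the unit ball which holds in every dimension `n ≥ 1`,
with an unspecified gain of integrability. -/
theorem exists_sobolev_ball (n : ℕ) (hn : 1 ≤ n) :
    ∃ κ : ℝ, 1 < κ ∧ ∃ S : NNReal, ∀ u : EuclideanSpace ℝ (Fin n) → ℝ, ContDiff ℝ 1 u →
      HasCompactSupport u → tsupport u ⊆ ball 0 1 →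
        ∫⁻ x, ‖u x‖ₑ ^ κ ≤ S * (∫⁻ x, ‖fderiv ℝ u x‖ₑ) ^ κ := by
  rcases hn.eq_or_lt with rfl | h
  · refine ⟨2, one_lt_two, (volume (ball (0 : EuclideanSpace ℝ (Fin 1)) 1)).toNNReal,
      fun u hu huc hus => ?_⟩
    rw [ENNReal.coe_toNNReal measure_ball_lt_top.ne, mul_comm, ← setLIntegral_const]
    have h0 : ∫⁻ x, ‖u x‖ₑ ^ (2 : ℝ) = ∫⁻ x in ball 0 1, ‖u x‖ₑ ^ (2 : ℝ) := by
      refine (setLIntegral_eq_of_support_subset fun x hx => ?_).symm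
      refine hus (subset_tsupport u fun h => hx ?_)
      simp [h]
    rw [h0]
    exact lintegral_mono fun x => ENNReal.rpow_le_rpow
      (enorm_le_lintegral_enorm_fderiv_of_fin_one hu huc x) zero_le_two
  · have hp : Real.HolderConjugate (Module.finrank ℝ (EuclideanSpace ℝ (Fin n)))
        (Real.conjExponent n) := by
      rw [finrank_euclideanSpace_fin]
      exact Real.HolderConjugate.conjExponent (by exact_mod_cast h)
    exact ⟨_, hp.symm.lt, lintegralPowLePowLIntegralFDerivConst volume (Real.conjExponent n),
      fun u hu huc _ => lintegral_pow_le_pow_lintegral_fderiv volume hu huc hp⟩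

/-- `exists_sobolev_ball` in terms of Bochner integrals. -/
theorem exists_sobolev_ball_integral (n : ℕ) (hn : 1 ≤ n) :
    ∃ κ : ℝ, 1 < κ ∧ ∃ S : ℝ, 1 ≤ S ∧ ∀ u : EuclideanSpace ℝ (Fin n) → ℝ, ContDiff ℝ 1 u →
      HasCompactSupport u → tsupport u ⊆ ball 0 1 → (∀ x, 0 ≤ u x) →
        ∫ x, u x ^ κ ≤ (S * ∫ x, ‖fderiv ℝ u x‖) ^ κ := by
  obtain ⟨κ, hκ, S, hS⟩ := exists_sobolev_ball n hn
  refine ⟨κ, hκ, max S 1, le_max_right _ _, fun u hu huc hus hu0 => ?_⟩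
  have hκ0 : 0 ≤ κ := by linarith
  have hI : Integrable fun x => ‖fderiv ℝ u x‖ :=
    (hu.continuous_fderiv one_ne_zero).norm.integrable_of_hasCompactSupport (huc.fderiv ℝ).norm
  have hI0 : 0 ≤ ∫ x, ‖fderiv ℝ u x‖ := integral_nonneg fun _ => norm_nonneg _
  have h := hS u hu huc hus
  have h1 : ∫⁻ x, ‖fderiv ℝ u x‖ₑ = ENNReal.ofReal (∫ x, ‖fderiv ℝ u x‖) := by
    rw [ofReal_integral_eq_lintegral_ofReal hI (Filter.Eventually.of_forall fun _ => norm_nonneg _)]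
    simp [ofReal_norm]
  have h2 : ∫ x, u x ^ κ = (∫⁻ x, ‖u x‖ₑ ^ κ).toReal := by
    rw [integral_eq_lintegral_of_nonneg_ae
      (Filter.Eventually.of_forall fun x => Real.rpow_nonneg (hu0 x) κ)
      (hu.continuous.rpow_const fun _ => Or.inr hκ0).aestronglyMeasurable]
    congr 1
    refine lintegral_congr fun x => ?_
    rw [← ENNReal.ofReal_rpow_of_nonneg (hu0 x) hκ0, Real.enorm_of_nonneg (hu0 x)]
  rw [h2, Real.mul_rpow (by positivity) hI0]
  refine ENNReal.toReal_le_of_le_ofReal (by positivity) (h.trans ?_)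
  rw [h1, ENNReal.ofReal_mul (by positivity), ENNReal.ofReal_rpow_of_nonneg hI0 hκ0]
  gcongr
  rw [← ENNReal.ofReal_coe_nnreal]
  refine ENNReal.ofReal_le_ofReal ((le_max_left (S : ℝ) 1).trans ?_)
  exact Real.self_le_rpow_of_one_le (le_max_right _ _) hκ.le

end Sobolev

section Cutoff

variable {E : Type*} [NormedAddCommGroup E] {R : ℝ}

/-- A `C¹` cutoff supported in the ball of radius `R`. -/
def paraboloidCutoff (R : ℝ) (x : E) : ℝ := (max (R ^ 2 - ‖x‖ ^ 2) 0) ^ 2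

theorem paraboloidCutoff_nonneg (R : ℝ) (x : E) : 0 ≤ paraboloidCutoff R x := sq_nonneg _

theorem max_sub_sq_eq_zero (hR : 0 ≤ R) {x : E} (hx : x ∉ ball (0 : E) R) :
    max (R ^ 2 - ‖x‖ ^ 2) 0 = 0 := by
  rw [mem_ball_zero_iff, not_lt] at hx
  exact max_eq_right (by nlinarith)

theorem paraboloidCutoff_eq_zero (hR : 0 ≤ R) {x : E} (hx : x ∉ ball (0 : E) R) :
    paraboloidCutoff R x = 0 := by
  simp [paraboloidCutoff, max_sub_sq_eq_zero hR hx]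

theorem max_sub_sq_le_one (hR : 0 ≤ R) (hR1 : R ≤ 1) (x : E) : max (R ^ 2 - ‖x‖ ^ 2) 0 ≤ 1 :=
  max_le (by nlinarith [sq_nonneg ‖x‖]) zero_le_one

theorem paraboloidCutoff_le_one (hR : 0 ≤ R) (hR1 : R ≤ 1) (x : E) :
    paraboloidCutoff R x ≤ 1 :=
  pow_le_one₀ (le_max_right _ _) (max_sub_sq_le_one hR hR1 x)

theorem sub_sq_le_paraboloidCutoff {r : ℝ} (hr : 1 / 2 ≤ r) (hrR : r < R) {x : E}
    (hx : x ∈ ball (0 : E) r) : (R - r) ^ 2 ≤ paraboloidCutoff R x := by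
  rw [mem_ball_zero_iff] at hx
  refine pow_le_pow_left₀ (by linarith) (le_max_of_le_left ?_) 2
  nlinarith [norm_nonneg x]

theorem tsupport_paraboloidCutoff_subset (hR : 0 ≤ R) :
    tsupport (paraboloidCutoff (E := E) R) ⊆ closedBall 0 R := by
  refine closure_minimal (fun x hx => ?_) isClosed_closedBall
  by_contra h
  exact hx (paraboloidCutoff_eq_zero hR fun h' => h (ball_subset_closedBall h'))

variable [InnerProductSpace ℝ E]

theorem hasFDerivAt_paraboloidCutoff (R : ℝ) (x : E) : HasFDerivAt (paraboloidCutoff R)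
    ((2 * max (R ^ 2 - ‖x‖ ^ 2) 0) • (-((2 : ℕ) • innerSL ℝ x) : E →L[ℝ] ℝ)) x := by
  have h2 : HasDerivAt (fun t : ℝ => (max t 0) ^ 2) (2 * (max (R ^ 2 - ‖x‖ ^ 2) 0))
      (R ^ 2 - ‖x‖ ^ 2) := by
    convert! hasDerivAt_max_zero_pow 0 _ using 1; norm_num
  exact h2.comp_hasFDerivAt x ((hasStrictFDerivAt_norm_sq x).hasFDerivAt.const_sub (R ^ 2))

theorem contDiff_paraboloidCutoff (R : ℝ) : ContDiff ℝ 1 (paraboloidCutoff (E := E) R) := by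
  rw [contDiff_one_iff_hasFDerivAt]
  refine ⟨_, ?_, hasFDerivAt_paraboloidCutoff R⟩
  have : Continuous fun x : E => innerSL ℝ x := (innerSL ℝ).continuous
  fun_prop

theorem fderiv_paraboloidCutoff_eq_zero (hR : 0 ≤ R) {x : E} (hx : x ∉ ball (0 : E) R) :
    fderiv ℝ (paraboloidCutoff R) x = 0 := by
  simp [(hasFDerivAt_paraboloidCutoff R x).fderiv, max_sub_sq_eq_zero hR hx]

theorem norm_fderiv_paraboloidCutoff_le (hR : 0 ≤ R) (hR1 : R ≤ 1) (x : E) :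
    ‖fderiv ℝ (paraboloidCutoff R) x‖ ≤ 4 := by
  by_cases hx : x ∈ ball (0 : E) R
  · rw [mem_ball_zero_iff] at hx
    have h1 := max_sub_sq_le_one hR hR1 x
    have h0 : 0 ≤ max (R ^ 2 - ‖x‖ ^ 2) 0 := le_max_right _ _
    rw [(hasFDerivAt_paraboloidCutoff R x).fderiv, norm_smul, norm_neg, ← Nat.cast_smul_eq_nsmul ℝ,
      norm_smul, innerSL_apply_norm, Real.norm_of_nonneg (by positivity)]
    have := norm_nonneg x
    norm_num
    nlinarith
  · simp [fderiv_paraboloidCutoff_eq_zero hR hx]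

theorem hasCompactSupport_paraboloidCutoff [FiniteDimensional ℝ E] (hR : 0 ≤ R) :
    HasCompactSupport (paraboloidCutoff (E := E) R) :=
  (isCompact_closedBall 0 R).of_isClosed_subset (isClosed_tsupport _)
    (tsupport_paraboloidCutoff_subset hR)

end Cutoff

section Moser

variable {n : ℕ} {f : EuclideanSpace ℝ (Fin n) → ℝ}

theorem integrableOn_ball_rpow (hf : ContDiffOn ℝ 1 f (ball 0 1)) {R p : ℝ} (hR : R < 1)
    (hp : 0 ≤ p) : IntegrableOn (fun x => f x ^ p) (ball 0 R) :=
  ((hf.continuousOn.mono (closedBall_subset_ball hR)).rpow_const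
    fun _ _ => Or.inr hp).integrableOn_compact (isCompact_closedBall 0 R)
    |>.mono_set ball_subset_closedBall

theorem norm_fderiv_cutoff_sq_mul_rpow_le {φ : EuclideanSpace ℝ (Fin n) → ℝ}
    {x : EuclideanSpace ℝ (Fin n)} (hφ : DifferentiableAt ℝ φ x) (hfd : DifferentiableAt ℝ f x)
    (hφ0 : 0 ≤ φ x) (hf0 : 0 ≤ f x) {q : ℝ} (hq : 1 ≤ q) :
    ‖fderiv ℝ (fun x => φ x ^ 2 * f x ^ (2 * q)) x‖ ≤
      (2 * φ x ^ 2 + ‖fderiv ℝ φ x‖ ^ 2) * f x ^ (2 * q) +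
        φ x ^ 2 * (q ^ 2 * f x ^ (2 * q - 2) * ‖fderiv ℝ f x‖ ^ 2) := by
  have hd := (hφ.hasFDerivAt.pow 2).mul
    (hfd.hasFDerivAt.rpow_const (p := 2 * q) (Or.inr (by linarith)))
  have hd' : fderiv ℝ (fun x => φ x ^ 2 * f x ^ (2 * q)) x =
      (φ x ^ 2 * (2 * q * f x ^ (2 * q - 1))) • fderiv ℝ f x +
        (f x ^ (2 * q) * (2 * φ x)) • fderiv ℝ φ x := by
    refine hd.fderiv.trans ?_
    ext z
    simp
    ring
  have h1 : f x ^ (2 * q - 1) = f x ^ q * f x ^ (q - 1) := by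
    rw [← Real.rpow_add_of_nonneg hf0 (by linarith) (by linarith)]; ring_nf
  have h2 : f x ^ (2 * q - 2) = (f x ^ (q - 1)) ^ 2 := by
    rw [← Real.rpow_mul_natCast hf0]; norm_num; ring_nf
  have h3 : f x ^ (2 * q) = (f x ^ q) ^ 2 := by
    rw [← Real.rpow_mul_natCast hf0]; norm_num; ring_nf
  rw [hd', h1, h2, h3]
  have ha : 0 ≤ f x ^ q := Real.rpow_nonneg hf0 _
  have hb : 0 ≤ f x ^ (q - 1) := Real.rpow_nonneg hf0 _
  refine (norm_add_le _ _).trans ?_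
  rw [norm_smul, norm_smul, Real.norm_of_nonneg (by positivity),
    Real.norm_of_nonneg (by positivity)]
  have e1 := mul_nonneg (sq_nonneg (φ x)) (sq_nonneg (f x ^ q - q * f x ^ (q - 1) * ‖fderiv ℝ f x‖))
  have e2 := mul_nonneg (sq_nonneg (f x ^ q)) (sq_nonneg (φ x - ‖fderiv ℝ φ x‖))
  nlinarith

/-- One step of the Moser iteration. -/
theorem moser_step {κ S K q r R : ℝ} (hκ : 1 < κ) (hS : 1 ≤ S) (hK : 0 ≤ K)
    (hSob : ∀ u : EuclideanSpace ℝ (Fin n) → ℝ, ContDiff ℝ 1 u →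
      HasCompactSupport u → tsupport u ⊆ ball 0 1 → (∀ x, 0 ≤ u x) →
        ∫ x, u x ^ κ ≤ (S * ∫ x, ‖fderiv ℝ u x‖) ^ κ)
    (hf : ContDiffOn ℝ 1 f (ball 0 1)) (hf0 : ∀ x ∈ ball 0 1, 0 ≤ f x) (hq : 1 ≤ q)
    (hE : ∀ φ : EuclideanSpace ℝ (Fin n) → ℝ, ContDiff ℝ 1 φ → HasCompactSupport φ →
      tsupport φ ⊆ ball 0 1 →
        ∫ x in ball 0 1, φ x ^ 2 * (q ^ 2 * f x ^ (2 * q - 2) * ‖fderiv ℝ f x‖ ^ 2) ≤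
          K * ∫ x in ball 0 1, ‖fderiv ℝ φ x‖ ^ 2 * f x ^ (2 * q))
    (hr : 1 / 2 ≤ r) (hrR : r < R) (hR : R < 1) :
    ∫ x in ball 0 r, f x ^ (2 * q * κ) ≤
      (S * (18 + 16 * K) / (R - r) ^ 4 * ∫ x in ball 0 R, f x ^ (2 * q)) ^ κ := by
  set φ : EuclideanSpace ℝ (Fin n) → ℝ := paraboloidCutoff R with hφdef
  have hR0 : 0 ≤ R := by linarith
  have hφ : ContDiff ℝ 1 φ := contDiff_paraboloidCutoff R
  have hφc : HasCompactSupport φ := hasCompactSupport_paraboloidCutoff hR0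
  have hφs : tsupport φ ⊆ ball 0 1 :=
    (tsupport_paraboloidCutoff_subset hR0).trans (closedBall_subset_ball hR)
  have hφ0 : ∀ x, 0 ≤ φ x := paraboloidCutoff_nonneg R
  have hsq : tsupport (fun x => φ x ^ 2) ⊆ tsupport φ := by
    simp only [sq]; exact tsupport_mul_subset_left
  have h2q : 0 ≤ 2 * q := by linarith
  have hfp : ContDiffOn ℝ 1 (fun x => f x ^ (2 * q)) (ball 0 1) :=
    (Real.contDiff_rpow_const_of_le (by push_cast; linarith)).comp_contDiffOn hf
  have hfp0 : ∀ {p : ℝ}, ∀ x ∈ ball (0 : EuclideanSpace ℝ (Fin n)) 1, 0 ≤ f x ^ p :=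
    fun x hx => Real.rpow_nonneg (hf0 x hx) _
  set u := fun x => φ x ^ 2 * f x ^ (2 * q) with hudef
  have hu : ContDiff ℝ 1 u :=
    contDiff_mul_of_tsupport_subset (hφ.pow 2) hfp isOpen_ball (hsq.trans hφs)
  have hut : tsupport u ⊆ tsupport φ := tsupport_mul_subset_left.trans hsq
  have huc : HasCompactSupport u := hφc.of_isClosed_subset (isClosed_tsupport _) hut
  have hu0 : ∀ x, 0 ≤ u x := fun x => by
    by_cases hx : x ∈ ball (0 : EuclideanSpace ℝ (Fin n)) 1
    · exact mul_nonneg (sq_nonneg _) (hfp0 x hx)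
    · simp [hudef, image_eq_zero_of_notMem_tsupport fun h => hx (hφs h)]
  have hsub1 : ball (0 : EuclideanSpace ℝ (Fin n)) R ⊆ ball 0 1 := ball_subset_ball hR.le
  have hsub2 : ball (0 : EuclideanSpace ℝ (Fin n)) r ⊆ ball 0 R := ball_subset_ball hrR.le
  have hgrad : ∫ x, ‖fderiv ℝ u x‖ ≤ (18 + 16 * K) * ∫ x in ball 0 R, f x ^ (2 * q) := by
    have hfc : ContinuousOn (fun x => ‖fderiv ℝ f x‖) (ball 0 1) :=
      (hf.continuousOn_fderiv_of_isOpen isOpen_ball le_rfl).norm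
    have hdt : tsupport (fun x => ‖fderiv ℝ φ x‖ ^ 2) ⊆ tsupport φ := by
      refine closure_minimal (fun x hx => ?_) (isClosed_tsupport φ)
      exact support_fderiv_subset ℝ (f := φ) fun h => hx (by simp [h])
    have hI1 : IntegrableOn (fun x => φ x ^ 2 *
        (q ^ 2 * f x ^ (2 * q - 2) * ‖fderiv ℝ f x‖ ^ 2)) (ball 0 1) :=
      (integrable_mul_of_tsupport_subset (hφ.continuous.pow 2)
        (hφc.of_isClosed_subset (isClosed_tsupport _) hsq)
        ((continuousOn_const.mul (hf.continuousOn.rpow_const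
          fun _ _ => Or.inr (by linarith))).mul (hfc.pow 2)) isOpen_ball
        (hsq.trans hφs)).integrableOn
    have hI2 : IntegrableOn (fun x => φ x ^ 2 * f x ^ (2 * q)) (ball 0 1) :=
      (integrable_mul_of_tsupport_subset (hφ.continuous.pow 2)
        (hφc.of_isClosed_subset (isClosed_tsupport _) hsq)
        hfp.continuousOn isOpen_ball (hsq.trans hφs)).integrableOn
    have hI3 : IntegrableOn (fun x => ‖fderiv ℝ φ x‖ ^ 2 * f x ^ (2 * q)) (ball 0 1) :=
      (integrable_mul_of_tsupport_subset ((hφ.continuous_fderiv one_ne_zero).norm.pow 2)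
        (hφc.of_isClosed_subset (isClosed_tsupport _) hdt)
        hfp.continuousOn isOpen_ball (hdt.trans hφs)).integrableOn
    have hI4 : IntegrableOn (fun x => (2 * φ x ^ 2 + ‖fderiv ℝ φ x‖ ^ 2) * f x ^ (2 * q))
        (ball 0 1) :=
      ((hI2.const_mul 2).add hI3).congr (Filter.Eventually.of_forall fun x => by
        simp only [Pi.add_apply]; ring)
    have hIu : Integrable fun x => ‖fderiv ℝ u x‖ :=
      (hu.continuous_fderiv one_ne_zero).norm.integrable_of_hasCompactSupport (huc.fderiv ℝ).norm
    have hcut : ∀ x, ‖fderiv ℝ φ x‖ ^ 2 ≤ 16 := fun x => by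
      have := norm_fderiv_paraboloidCutoff_le hR0 hR.le x
      nlinarith [norm_nonneg (fderiv ℝ φ x)]
    have hcut1 : ∀ x, φ x ^ 2 ≤ 1 := fun x =>
      pow_le_one₀ (hφ0 x) (paraboloidCutoff_le_one hR0 hR.le x)
    have hIf := integrableOn_ball_rpow hf hR h2q
    have hb1 : ∫ x in ball 0 1, (2 * φ x ^ 2 + ‖fderiv ℝ φ x‖ ^ 2) * f x ^ (2 * q) ≤
        18 * ∫ x in ball 0 R, f x ^ (2 * q) := by
      rw [setIntegral_eq_of_subset_of_forall_sdiff_eq_zero measurableSet_ball hsub1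
        (fun x hx => by
          simp [hφdef, paraboloidCutoff_eq_zero hR0 hx.2,
            fderiv_paraboloidCutoff_eq_zero hR0 hx.2]), ← integral_const_mul]
      refine setIntegral_mono_on (hI4.mono_set hsub1) (hIf.const_mul _) measurableSet_ball
        fun x hx => mul_le_mul_of_nonneg_right ?_ (hfp0 x (hsub1 hx))
      linarith [hcut x, hcut1 x]
    have hb2 : ∫ x in ball 0 1, ‖fderiv ℝ φ x‖ ^ 2 * f x ^ (2 * q) ≤
        16 * ∫ x in ball 0 R, f x ^ (2 * q) := by
      rw [setIntegral_eq_of_subset_of_forall_sdiff_eq_zero measurableSet_ball hsub1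
        (fun x hx => by
          simp [hφdef, fderiv_paraboloidCutoff_eq_zero hR0 hx.2]), ← integral_const_mul]
      exact setIntegral_mono_on (hI3.mono_set hsub1) (hIf.const_mul _) measurableSet_ball
        fun x hx => mul_le_mul_of_nonneg_right (hcut x) (hfp0 x (hsub1 hx))
    calc ∫ x, ‖fderiv ℝ u x‖ = ∫ x in ball 0 1, ‖fderiv ℝ u x‖ := by
          refine (setIntegral_eq_integral_of_forall_compl_eq_zero fun x hx => ?_).symm
          by_contra h
          exact hx (hφs (hut (support_fderiv_subset ℝ fun h' => h (by simp [h']))))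
      _ ≤ ∫ x in ball 0 1, ((2 * φ x ^ 2 + ‖fderiv ℝ φ x‖ ^ 2) * f x ^ (2 * q) +
          φ x ^ 2 * (q ^ 2 * f x ^ (2 * q - 2) * ‖fderiv ℝ f x‖ ^ 2)) :=
        setIntegral_mono_on hIu.integrableOn (hI4.add hI1) measurableSet_ball fun x hx =>
          norm_fderiv_cutoff_sq_mul_rpow_le (hφ.differentiable one_ne_zero x)
            ((hf.differentiableOn one_ne_zero).differentiableAt (isOpen_ball.mem_nhds hx))
            (hφ0 x) (hf0 x hx) hq
      _ ≤ 18 * (∫ x in ball 0 R, f x ^ (2 * q)) +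
          K * (16 * ∫ x in ball 0 R, f x ^ (2 * q)) := by
        rw [integral_add hI4 hI1]
        exact add_le_add hb1 ((hE φ hφ hφc hφs).trans (mul_le_mul_of_nonneg_left hb2 hK))
      _ = _ := by ring
  have hκ0 : 0 ≤ κ := by linarith
  have hd : 0 < (R - r) ^ 4 := pow_pos (sub_pos.2 hrR) 4
  have hlow : ((R - r) ^ 4) ^ κ * ∫ x in ball 0 r, f x ^ (2 * q * κ) ≤ ∫ x, u x ^ κ := by
    have hIu : Integrable fun x => u x ^ κ :=
      (hu.continuous.rpow_const fun _ => Or.inr hκ0).integrable_of_hasCompactSupport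
        (huc.comp_left (g := fun t : ℝ => t ^ κ) (Real.zero_rpow (by linarith)))
    refine le_trans ?_ (setIntegral_le_integral (s := ball 0 r) hIu
      (Filter.Eventually.of_forall fun x => Real.rpow_nonneg (hu0 x) κ))
    rw [← integral_const_mul]
    refine setIntegral_mono_on ((integrableOn_ball_rpow hf (hrR.trans hR)
      (by positivity)).const_mul _) hIu.integrableOn measurableSet_ball fun x hx => ?_
    have hx1 := hsub1 (hsub2 hx)
    rw [Real.rpow_mul (hf0 x hx1), ← Real.mul_rpow hd.le (hfp0 x hx1)]
    refine Real.rpow_le_rpow (mul_nonneg hd.le (hfp0 x hx1)) ?_ hκ0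
    refine mul_le_mul_of_nonneg_right ?_ (hfp0 x hx1)
    have := sub_sq_le_paraboloidCutoff hr hrR hx
    calc (R - r) ^ 4 = ((R - r) ^ 2) ^ 2 := by ring
      _ ≤ _ := pow_le_pow_left₀ (sq_nonneg _) this 2
  have hfin := hlow.trans (hSob u hu huc (hut.trans hφs) hu0)
  have hg0 : 0 ≤ ∫ x, ‖fderiv ℝ u x‖ := integral_nonneg fun _ => norm_nonneg _
  have hfin2 : (S * ∫ x, ‖fderiv ℝ u x‖) ^ κ ≤
      (S * ((18 + 16 * K) * ∫ x in ball 0 R, f x ^ (2 * q))) ^ κ :=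
    Real.rpow_le_rpow (by positivity) (by gcongr) hκ0
  have hJ0 : 0 ≤ ∫ x in ball 0 R, f x ^ (2 * q) :=
    setIntegral_nonneg measurableSet_ball fun x hx => hfp0 x (hsub1 hx)
  rw [show S * (18 + 16 * K) / (R - r) ^ 4 * ∫ x in ball 0 R, f x ^ (2 * q) =
    (S * ((18 + 16 * K) * ∫ x in ball 0 R, f x ^ (2 * q))) / (R - r) ^ 4 by ring,
    Real.div_rpow (by positivity) hd.le, le_div_iff₀ (Real.rpow_pos_of_pos hd κ), mul_comm]
  exact hfin.trans hfin2

end Moser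

theorem exists_forall_le_rpow_of_recursion {κ T : ℝ} (hκ : 1 < κ) (hT : 1 < T) (C₀ : ℝ) :
    ∃ D > (0 : ℝ), ∀ Y : ℕ → ℝ, (∀ k, 0 ≤ Y k) → Y 0 ≤ C₀ →
      (∀ k, Y (k + 1) ≤ (T ^ (k + 1) * Y k) ^ κ) → ∀ k, Y k ≤ D ^ (κ ^ k) := by
  have hT0 : 0 < T := by linarith
  have hκ1 : κ - 1 ≠ 0 := by linarith
  set α := κ / (κ - 1) with hα
  set β := (κ + α) / (κ - 1) with hβ
  have hα0 : 0 ≤ α := div_nonneg (by linarith) (by linarith)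
  have hβ0 : 0 ≤ β := div_nonneg (by linarith) (by linarith)
  set e := β + Real.logb T (max C₀ 1) with he
  refine ⟨T ^ e, Real.rpow_pos_of_pos hT0 _, fun Y hY0 hYC hrec k => ?_⟩
  have key : ∀ k : ℕ, Y k ≤ T ^ (e * κ ^ k - α * k - β) := by
    intro k
    induction k with
    | zero =>
      refine hYC.trans ((le_max_left C₀ 1).trans (le_of_eq ?_))
      rw [he]
      norm_num
      rw [Real.rpow_logb hT0 hT.ne' (by positivity)]
    | succ k ih =>
      refine (hrec k).trans ?_
      have h1 : T ^ (k + 1) * Y k ≤ T ^ ((k : ℝ) + 1 + (e * κ ^ k - α * k - β)) := by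
        rw [Real.rpow_add hT0, ← Nat.cast_succ, Real.rpow_natCast]
        gcongr
      refine (Real.rpow_le_rpow (mul_nonneg (by positivity) (hY0 k)) h1 (by linarith)).trans
        (le_of_eq ?_)
      rw [← Real.rpow_mul hT0.le]
      congr 1
      rw [hβ, hα]
      push_cast
      field_simp
      ring
  rw [← Real.rpow_mul hT0.le]
  refine (key k).trans (Real.rpow_le_rpow_of_exponent_le hT.le ?_)
  have : 0 ≤ α * k := by positivity
  linarith

section SupBound

variable {E : Type*} [NormedAddCommGroup E]  [MeasurableSpace E] [BorelSpace E] {μ : Measure E} [μ.IsAddHaarMeasure]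

theorem le_of_forall_setIntegral_rpow_le {g : E → ℝ} {U : Set E} (hU : IsOpen U)
    (hUb : μ U ≠ ⊤) (hg : ContinuousOn g U) (hg0 : ∀ x ∈ U, 0 ≤ g x) {κ D : ℝ} (hκ : 1 < κ)
    (hD : 0 < D) (hint : ∀ k : ℕ, IntegrableOn (fun x => g x ^ (κ ^ k)) U μ)
    (h : ∀ k : ℕ, ∫ x in U, g x ^ (κ ^ k) ∂μ ≤ D ^ (κ ^ k)) {x : E} (hx : x ∈ U) : g x ≤ D := by
  by_contra! hlt
  obtain ⟨s, hDs, hsg⟩ := exists_between hlt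
  have hs0 : 0 < s := hD.trans hDs
  set V := U ∩ g ⁻¹' Set.Ioi s with hV
  have hVo : IsOpen V := hg.isOpen_inter_preimage hU isOpen_Ioi
  have hVU : V ⊆ U := Set.inter_subset_left
  have hVtop : μ V ≠ ⊤ := measure_ne_top_of_subset hVU hUb
  have hVpos : 0 < μ.real V :=
    ENNReal.toReal_pos (hVo.measure_pos μ ⟨x, hx, hsg⟩).ne' hVtop
  have hle : ∀ k : ℕ, μ.real V ≤ (D / s) ^ (κ ^ k) := by
    intro k
    have hκk : 0 ≤ κ ^ k := by positivity
    rw [Real.div_rpow hD.le hs0.le, le_div_iff₀ (Real.rpow_pos_of_pos hs0 _)]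
    calc μ.real V * s ^ (κ ^ k) = ∫ _ in V, s ^ (κ ^ k) ∂μ := by
          rw [setIntegral_const, smul_eq_mul]
      _ ≤ ∫ x in V, g x ^ (κ ^ k) ∂μ :=
        setIntegral_mono_on (integrableOn_const hVtop) ((hint k).mono_set hVU) hVo.measurableSet
          fun y hy => Real.rpow_le_rpow hs0.le (le_of_lt hy.2) hκk
      _ ≤ ∫ x in U, g x ^ (κ ^ k) ∂μ := by
        refine setIntegral_mono_set (hint k) ?_ (Filter.Eventually.of_forall hVU)
        filter_upwards [ae_restrict_mem hU.measurableSet] with y hy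
        exact Real.rpow_nonneg (hg0 y hy) _
      _ ≤ _ := h k
  have hlim : Filter.Tendsto (fun k : ℕ => (D / s) ^ (κ ^ k)) Filter.atTop (nhds 0) :=
    (tendsto_rpow_atTop_of_base_lt_one _ (by have := div_pos hD hs0; linarith)
      ((div_lt_one hs0).2 hDs)).comp (tendsto_pow_atTop_atTop_of_one_lt hκ)
  exact absurd (ge_of_tendsto' hlim hle) (not_le.2 hVpos)

end SupBound

/-- Local boundedness: a function satisfying the energy inequalities of all of its powers is
bounded on the half ball in terms of its `L²` norm on a larger ball. -/
theorem exists_moser_bound (n : ℕ) (hn : 1 ≤ n) {K : ℝ} (hK : 0 ≤ K) (C₀ : ℝ) :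
    ∃ C : ℝ, ∀ r : ℝ, 3 / 4 ≤ r → r < 1 → ∀ f : EuclideanSpace ℝ (Fin n) → ℝ,
      ContDiffOn ℝ 1 f (ball 0 1) → (∀ x ∈ ball 0 1, 0 ≤ f x) →
      (∀ q : ℝ, 1 ≤ q → ∀ φ : EuclideanSpace ℝ (Fin n) → ℝ, ContDiff ℝ 1 φ →
        HasCompactSupport φ → tsupport φ ⊆ ball 0 1 →
        ∫ x in ball 0 1, φ x ^ 2 * (q ^ 2 * f x ^ (2 * q - 2) * ‖fderiv ℝ f x‖ ^ 2) ≤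
          K * ∫ x in ball 0 1, ‖fderiv ℝ φ x‖ ^ 2 * f x ^ (2 * q)) →
      ∫ x in ball 0 r, f x ^ 2 ≤ C₀ → ∀ x ∈ ball 0 (1 / 2), f x ≤ C := by
  obtain ⟨κ, hκ, S, hS, hSob⟩ := exists_sobolev_ball_integral n hn
  set M := S * (18 + 16 * K) with hM
  have hM1 : 1 ≤ M := by nlinarith
  set T := M * 16 ^ 3 with hTdef
  have hT16 : 16 ≤ T := by rw [hTdef]; linarith
  obtain ⟨D, hD, hrec⟩ := exists_forall_le_rpow_of_recursion hκ (T := T) (by linarith) C₀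
  refine ⟨√D, fun r hr hr1 f hf hf0 hE hf2 x hx => ?_⟩
  set ρ : ℕ → ℝ := fun k => 1 / 2 + (r - 1 / 2) / 2 ^ k with hρ
  have hρhalf : ∀ k, 1 / 2 < ρ k := fun k => by
    have : 0 < (r - 1 / 2) / 2 ^ k := div_pos (by linarith) (by positivity)
    simp only [hρ]; linarith
  have hρr : ∀ k, ρ k ≤ r := fun k => by
    have : (r - 1 / 2) / 2 ^ k ≤ r - 1 / 2 :=
      div_le_self (by linarith) (one_le_pow₀ one_le_two)
    simp only [hρ]; linarith
  have hρsub : ∀ k, 1 / 2 ^ (k + 3) ≤ ρ k - ρ (k + 1) := fun k => by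
    have : ρ k - ρ (k + 1) = (r - 1 / 2) * 4 / 2 ^ (k + 3) := by
      simp only [hρ]; field_simp; ring
    rw [this]
    gcongr
    linarith
  have hκk : ∀ k : ℕ, 1 ≤ κ ^ k := fun k => one_le_pow₀ hκ.le
  have hnn : ∀ {p s : ℝ}, s ≤ 1 → 0 ≤ ∫ x in ball 0 s, f x ^ p := fun hs =>
    setIntegral_nonneg measurableSet_ball fun y hy =>
      Real.rpow_nonneg (hf0 y (ball_subset_ball hs hy)) _
  have hbound := hrec (fun k => ∫ x in ball 0 (ρ k), f x ^ (2 * κ ^ k))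
    (fun k => hnn ((hρr k).trans hr1.le)) (by simpa [hρ] using hf2) (fun k => by
      have hlt : ρ (k + 1) < ρ k := by
        have := hρsub k
        have : (0 : ℝ) < 1 / 2 ^ (k + 3) := by positivity
        linarith
      have h := moser_step hκ hS hK hSob hf hf0 (hκk k) (hE _ (hκk k)) (hρhalf (k + 1)).le hlt
        ((hρr k).trans_lt hr1)
      have hY : 0 ≤ ∫ x in ball 0 (ρ k), f x ^ (2 * κ ^ k) := hnn ((hρr k).trans hr1.le)
      have hpos : 0 < ρ k - ρ (k + 1) := sub_pos.2 hlt
      have hexp : 2 * κ ^ (k + 1) = 2 * κ ^ k * κ := by ring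
      simp only [hexp]
      refine h.trans (Real.rpow_le_rpow (by positivity) ?_ (by linarith))
      refine mul_le_mul_of_nonneg_right ?_ hY
      rw [← hM, div_le_iff₀ (by positivity)]
      have h4 : (1 / 2 ^ (k + 3)) ^ 4 ≤ (ρ k - ρ (k + 1)) ^ 4 :=
        pow_le_pow_left₀ (by positivity) (hρsub k) 4
      have h16 : M * 16 ^ 3 * 16 ^ k ≤ T ^ (k + 1) := by
        rw [pow_succ T k, mul_comm (T ^ k), ← hTdef]
        gcongr
      calc M = M * 16 ^ 3 * 16 ^ k * (1 / 2 ^ (k + 3)) ^ 4 := by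
            rw [div_pow, one_pow, ← pow_mul, mul_comm (k + 3) 4, pow_mul, pow_add]
            norm_num
            field_simp
        _ ≤ T ^ (k + 1) * (ρ k - ρ (k + 1)) ^ 4 := by gcongr)
  have hsub : ∀ k, ball (0 : EuclideanSpace ℝ (Fin n)) (1 / 2) ⊆ ball 0 (ρ k) := fun k =>
    ball_subset_ball (hρhalf k).le
  have hsub1 : ball (0 : EuclideanSpace ℝ (Fin n)) (1 / 2) ⊆ ball 0 1 :=
    ball_subset_ball (by norm_num)
  have hpow : ∀ (k : ℕ), ∀ y ∈ ball (0 : EuclideanSpace ℝ (Fin n)) 1,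
      f y ^ (2 * κ ^ k) = (f y ^ 2) ^ (κ ^ k) := fun k y hy => by
    rw [Real.rpow_mul (hf0 y hy), Real.rpow_two]
  have hint : ∀ (k : ℕ) {s : ℝ}, s < 1 →
      IntegrableOn (fun y => f y ^ (2 * κ ^ k)) (ball 0 s) := fun k s hs =>
    integrableOn_ball_rpow hf hs (by have := hκk k; linarith)
  have hsq : f x ^ 2 ≤ D := by
    refine le_of_forall_setIntegral_rpow_le (μ := volume) (g := fun y => f y ^ 2) isOpen_ball
      measure_ball_lt_top.ne ((hf.continuousOn.mono hsub1).pow 2) (fun y _ => sq_nonneg _) hκ hD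
      (fun k => ?_) (fun k => ?_) hx
    · exact (hint k (by norm_num)).congr_fun (fun y hy => hpow k y (hsub1 hy)) measurableSet_ball
    · refine le_trans ?_ (hbound k)
      rw [← setIntegral_congr_fun measurableSet_ball fun y hy => hpow k y (hsub1 hy)]
      refine setIntegral_mono_set (hint k ((hρr k).trans_lt hr1)) ?_
        (Filter.Eventually.of_forall (hsub k))
      filter_upwards [ae_restrict_mem measurableSet_ball] with y hy
      exact Real.rpow_nonneg (hf0 y (ball_subset_ball ((hρr k).trans hr1.le) hy)) _
  exact Real.le_sqrt_of_sq_le hsq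

section Poincare

variable {E : Type*} [NormedAddCommGroup E] [NormedSpace ℝ E]

theorem sq_intervalIntegral_le {k : ℝ → ℝ} (hk : ContinuousOn k (Set.Icc 0 1)) :
    (∫ t in (0 : ℝ)..1, k t) ^ 2 ≤ ∫ t in (0 : ℝ)..1, k t ^ 2 := by
  set c := ∫ t in (0 : ℝ)..1, k t with hc
  have hi : IntervalIntegrable k volume 0 1 := hk.intervalIntegrable_of_Icc zero_le_one
  have hi2 : IntervalIntegrable (fun t => k t ^ 2) volume 0 1 :=
    (hk.pow 2).intervalIntegrable_of_Icc zero_le_one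
  have h1 : IntervalIntegrable (fun t => 2 * c * k t) volume 0 1 := hi.const_mul _
  have hle : ∫ t in (0 : ℝ)..1, (2 * c * k t - c ^ 2) ≤ ∫ t in (0 : ℝ)..1, k t ^ 2 :=
    intervalIntegral.integral_mono_on zero_le_one (h1.sub intervalIntegrable_const) hi2
      fun t _ => by nlinarith [sq_nonneg (k t - c)]
  rw [intervalIntegral.integral_sub h1 intervalIntegrable_const,
    intervalIntegral.integral_const_mul, ← hc] at hle
  simp at hle
  nlinarith

theorem ofReal_sq_le_lintegral_segment {B : Set E} (hB : IsOpen B) (hBc : Convex ℝ B)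
    {f : E → ℝ} (hf : ContDiffOn ℝ 1 f B) {x y : E} (hx : x ∈ B) (hy : y ∈ B)
    (hxy : ‖x - y‖ ≤ 2) (hfy : f y = 0) :
    ENNReal.ofReal (f x ^ 2) ≤
      4 * ∫⁻ t in Set.Ioc (0 : ℝ) 1, ‖fderiv ℝ f (y + t • (x - y))‖ₑ ^ 2 := by
  have hmem : ∀ t ∈ Set.Icc (0 : ℝ) 1, y + t • (x - y) ∈ B := fun t ht =>
    hBc.add_smul_sub_mem hy hx ht
  have hγ : ∀ t, HasDerivAt (fun t : ℝ => y + t • (x - y)) (x - y) t := fun t => by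
    simpa using ((hasDerivAt_id t).smul_const (x - y)).const_add y
  have hcont : ContinuousOn (fun t : ℝ => fderiv ℝ f (y + t • (x - y))) (Set.Icc 0 1) :=
    (hf.continuousOn_fderiv_of_isOpen hB le_rfl).comp
      (fun t _ => (hγ t).continuousAt.continuousWithinAt) hmem
  have hk : ContinuousOn (fun t : ℝ => fderiv ℝ f (y + t • (x - y)) (x - y)) (Set.Icc 0 1) :=
    hcont.clm_apply continuousOn_const
  have hftc : ∫ t in (0 : ℝ)..1, fderiv ℝ f (y + t • (x - y)) (x - y) = f x := by
    have := intervalIntegral.integral_eq_sub_of_hasDerivAt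
      (f := fun t : ℝ => f (y + t • (x - y))) (a := 0) (b := 1) (fun t ht => by
        rw [Set.uIcc_of_le zero_le_one] at ht
        exact (((hf.differentiableOn one_ne_zero).differentiableAt
          (hB.mem_nhds (hmem t ht))).hasFDerivAt).comp_hasDerivAt t (hγ t))
      (hk.intervalIntegrable_of_Icc zero_le_one)
    rw [this]
    simp [hfy]
  have hn : ContinuousOn (fun t : ℝ => 4 * ‖fderiv ℝ f (y + t • (x - y))‖ ^ 2) (Set.Icc 0 1) :=
    continuousOn_const.mul (hcont.norm.pow 2)
  have hreal : f x ^ 2 ≤ ∫ t in Set.Ioc (0 : ℝ) 1, 4 * ‖fderiv ℝ f (y + t • (x - y))‖ ^ 2 := by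
    rw [← intervalIntegral.integral_of_le zero_le_one]
    conv_lhs => rw [← hftc]
    refine (sq_intervalIntegral_le hk).trans (intervalIntegral.integral_mono_on zero_le_one
      ((hk.pow 2).intervalIntegrable_of_Icc zero_le_one)
      (hn.intervalIntegrable_of_Icc zero_le_one) fun t _ => ?_)
    have h := (fderiv ℝ f (y + t • (x - y))).le_opNorm (x - y)
    rw [← sq_abs, ← Real.norm_eq_abs]
    have h2 : ‖fderiv ℝ f (y + t • (x - y)) (x - y)‖ ≤ ‖fderiv ℝ f (y + t • (x - y))‖ * 2 :=
      h.trans (by gcongr)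
    calc _ ≤ (‖fderiv ℝ f (y + t • (x - y))‖ * 2) ^ 2 := by gcongr
      _ = _ := by ring
  refine (ENNReal.ofReal_le_ofReal hreal).trans ?_
  rw [ofReal_integral_eq_lintegral_ofReal
    ((hn.integrableOn_Icc).mono_set Set.Ioc_subset_Icc_self)
    (Filter.Eventually.of_forall fun t => by positivity),
    ← lintegral_const_mul' _ _ (by norm_num)]
  refine lintegral_mono fun t => le_of_eq ?_
  rw [ENNReal.ofReal_mul (by norm_num), ENNReal.ofReal_pow (norm_nonneg _), ofReal_norm]
  norm_num

variable [FiniteDimensional ℝ E] [MeasurableSpace E] [BorelSpace E] (μ : Measure E)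
  [μ.IsAddHaarMeasure]

theorem lintegral_comp_add_smul_le {H : E → ENNReal} (hH : Measurable H) (c : E) {t : ℝ}
    (ht : 1 / 2 ≤ t) :
    ∫⁻ x, H (c + t • x) ∂μ ≤ 2 ^ Module.finrank ℝ E * ∫⁻ x, H x ∂μ := by
  have ht0 : 0 < t := by linarith
  have h1 : ∫⁻ x, H (c + t • x) ∂μ = ∫⁻ x, H (c + x) ∂(μ.map (t • ·)) :=
    (lintegral_map (f := fun x => H (c + x)) (hH.comp (measurable_const_add c))
      (measurable_const_smul t)).symm
  rw [h1, Measure.map_addHaar_smul μ ht0.ne', lintegral_smul_measure,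
    lintegral_add_left_eq_self H c, smul_eq_mul]
  refine mul_le_mul_left ?_ _
  rw [abs_of_pos (by positivity), ← inv_pow]
  calc ENNReal.ofReal (t⁻¹ ^ Module.finrank ℝ E) ≤ ENNReal.ofReal (2 ^ Module.finrank ℝ E) := by
        refine ENNReal.ofReal_le_ofReal (pow_le_pow_left₀ (by positivity) ?_ _)
        rw [inv_le_comm₀ ht0 two_pos]; linarith
    _ = _ := by rw [ENNReal.ofReal_pow zero_le_two]; norm_num

theorem lintegral_lintegral_segment_le {H : E → ENNReal} (hH : Measurable H) (B : Set E) (t : ℝ) :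
    ∫⁻ x in B, ∫⁻ y in B, H (y + t • (x - y)) ∂μ ∂μ ≤
      2 ^ Module.finrank ℝ E * μ B * ∫⁻ x, H x ∂μ := by
  have key : ∀ s : ℝ, 1 / 2 ≤ s → ∀ c : E → E, ∫⁻ x in B, ∫⁻ y in B, H (c x + s • y) ∂μ ∂μ ≤
      2 ^ Module.finrank ℝ E * μ B * ∫⁻ x, H x ∂μ := fun s hs c => by
    calc _ ≤ ∫⁻ _ in B, 2 ^ Module.finrank ℝ E * ∫⁻ x, H x ∂μ ∂μ :=
          lintegral_mono fun x => (setLIntegral_le_lintegral _ _).trans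
            (lintegral_comp_add_smul_le μ hH (c x) hs)
      _ = _ := by rw [setLIntegral_const]; ring
  rcases le_total (1 / 2) t with ht | ht
  · rw [lintegral_lintegral_swap (by fun_prop)]
    refine le_trans (le_of_eq ?_) (key t ht fun y => (1 - t) • y)
    congr! 5
    module
  · refine le_trans (le_of_eq ?_) (key (1 - t) (by linarith) fun x => t • x)
    congr! 5
    module

/-- A Poincaré inequality for functions vanishing on a set of positive measure. -/
theorem lintegral_poincare {B Z : Set E} (hB : IsOpen B) (hBc : Convex ℝ B)
    (hdiam : ∀ x ∈ B, ∀ y ∈ B, ‖x - y‖ ≤ 2) (hZm : MeasurableSet Z) (hZB : Z ⊆ B) {f : E → ℝ}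
    (hf : ContDiffOn ℝ 1 f B) (hfZ : ∀ y ∈ Z, f y = 0) :
    μ Z * ∫⁻ x in B, ENNReal.ofReal (f x ^ 2) ∂μ ≤
      4 * 2 ^ Module.finrank ℝ E * μ B * ∫⁻ x in B, ‖fderiv ℝ f x‖ₑ ^ 2 ∂μ := by
  set H : E → ENNReal := B.indicator fun x => ‖fderiv ℝ f x‖ₑ ^ 2 with hHdef
  have hH : Measurable H :=
    ((measurable_fderiv ℝ f).enorm.pow_const 2).indicator hB.measurableSet
  have hpt : ∀ x ∈ B, ∀ y ∈ Z, ENNReal.ofReal (f x ^ 2) ≤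
      4 * ∫⁻ t in Set.Ioc (0 : ℝ) 1, H (y + t • (x - y)) := fun x hx y hy => by
    refine (ofReal_sq_le_lintegral_segment hB hBc hf hx (hZB hy) (hdiam x hx y (hZB hy))
      (hfZ y hy)).trans (le_of_eq ?_)
    congr 1
    refine setLIntegral_congr_fun measurableSet_Ioc fun t ht => ?_
    rw [hHdef, Set.indicator_of_mem
      (hBc.add_smul_sub_mem (hZB hy) hx (Set.Ioc_subset_Icc_self ht))]
  calc μ Z * ∫⁻ x in B, ENNReal.ofReal (f x ^ 2) ∂μ
      ≤ ∫⁻ x in B, μ Z * ENNReal.ofReal (f x ^ 2) ∂μ := lintegral_const_mul_le _ _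
    _ = ∫⁻ x in B, ∫⁻ _ in Z, ENNReal.ofReal (f x ^ 2) ∂μ ∂μ := by
      simp only [setLIntegral_const, mul_comm]
    _ ≤ ∫⁻ x in B, ∫⁻ y in Z, 4 * ∫⁻ t in Set.Ioc (0 : ℝ) 1, H (y + t • (x - y)) ∂volume ∂μ ∂μ :=
      setLIntegral_mono' hB.measurableSet fun x hx => setLIntegral_mono' hZm fun y hy =>
        hpt x hx y hy
    _ ≤ ∫⁻ x in B, ∫⁻ y in B, 4 * ∫⁻ t in Set.Ioc (0 : ℝ) 1, H (y + t • (x - y)) ∂volume ∂μ ∂μ :=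
      lintegral_mono fun x => lintegral_mono_set hZB
    _ = 4 * ∫⁻ x in B, ∫⁻ y in B, ∫⁻ t in Set.Ioc (0 : ℝ) 1, H (y + t • (x - y)) ∂volume ∂μ ∂μ := by
      simp only [lintegral_const_mul' _ _ (show (4 : ENNReal) ≠ ⊤ by norm_num)]
    _ = 4 * ∫⁻ x in B, ∫⁻ t in Set.Ioc (0 : ℝ) 1, ∫⁻ y in B, H (y + t • (x - y)) ∂μ ∂volume ∂μ := by
      congr 1
      refine lintegral_congr fun x => lintegral_lintegral_swap (by fun_prop)
    _ = 4 * ∫⁻ t in Set.Ioc (0 : ℝ) 1, ∫⁻ x in B, ∫⁻ y in B, H (y + t • (x - y)) ∂μ ∂μ := by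
      congr 1
      refine lintegral_lintegral_swap (Measurable.aemeasurable ?_)
      have : Measurable fun p : (E × ℝ) × E => H (p.2 + p.1.2 • (p.1.1 - p.2)) := by fun_prop
      exact this.lintegral_prod_right'
    _ ≤ 4 * ∫⁻ _ in Set.Ioc (0 : ℝ) 1, 2 ^ Module.finrank ℝ E * μ B * ∫⁻ x, H x ∂μ := by
      gcongr
      exact lintegral_lintegral_segment_le μ hH B _
    _ = _ := by
      rw [setLIntegral_const, Real.volume_Ioc, hHdef, lintegral_indicator hB.measurableSet]
      norm_num [mul_assoc]

end Poincare

section Oscillation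

variable {n : ℕ} {f : EuclideanSpace ℝ (Fin n) → ℝ} {r : ℝ}

theorem integrableOn_ball_sq_norm_fderiv (hf : ContDiffOn ℝ 1 f (ball 0 1)) (hr1 : r < 1) :
    IntegrableOn (fun x => ‖fderiv ℝ f x‖ ^ 2) (ball 0 r) :=
  ((((hf.continuousOn_fderiv_of_isOpen isOpen_ball le_rfl).mono
    (closedBall_subset_ball hr1)).norm.pow 2).integrableOn_compact
      (isCompact_closedBall 0 r)).mono_set ball_subset_closedBall

theorem setIntegral_sq_norm_fderiv_le {K : ℝ} (hK : 0 ≤ K) (hr : 3 / 4 ≤ r) (hr1 : r < 1)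
    (hf : ContDiffOn ℝ 1 f (ball 0 1))
    (hE : ∀ φ : EuclideanSpace ℝ (Fin n) → ℝ, ContDiff ℝ 1 φ → HasCompactSupport φ →
      tsupport φ ⊆ ball 0 1 →
      ∫ x in ball 0 1, φ x ^ 2 * ‖fderiv ℝ f x‖ ^ 2 ≤ K * ∫ x in ball 0 1, ‖fderiv ℝ φ x‖ ^ 2) :
    ∫ x in ball 0 r, ‖fderiv ℝ f x‖ ^ 2 ≤
      K * (16 * volume.real (ball (0 : EuclideanSpace ℝ (Fin n)) 1)) / ((1 - r) / 2) ^ 4 := by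
  set R := (1 + r) / 2 with hR
  have hR0 : 0 ≤ R := by rw [hR]; linarith
  have hR1 : R < 1 := by rw [hR]; linarith
  have hrR : r < R := by rw [hR]; linarith
  set φ : EuclideanSpace ℝ (Fin n) → ℝ := paraboloidCutoff R with hφdef
  have hφ : ContDiff ℝ 1 φ := contDiff_paraboloidCutoff R
  have hφc : HasCompactSupport φ := hasCompactSupport_paraboloidCutoff hR0
  have hφs : tsupport φ ⊆ ball 0 1 :=
    (tsupport_paraboloidCutoff_subset hR0).trans (closedBall_subset_ball hR1)
  have hg : ContinuousOn (fun x => ‖fderiv ℝ f x‖ ^ 2) (ball 0 1) :=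
    (hf.continuousOn_fderiv_of_isOpen isOpen_ball le_rfl).norm.pow 2
  have hint : Integrable (fun x => φ x ^ 2 * ‖fderiv ℝ f x‖ ^ 2) := by
    have h := integrable_mul_of_tsupport_subset (μ := volume) (w := fun x => φ x *
      ‖fderiv ℝ f x‖ ^ 2) hφ.continuous hφc (hφ.continuous.continuousOn.mul hg) isOpen_ball hφs
    refine h.congr (Filter.Eventually.of_forall fun x => ?_)
    simp only
    ring
  rw [le_div_iff₀ (pow_pos (by linarith) 4), mul_comm]
  calc ((1 - r) / 2) ^ 4 * ∫ x in ball 0 r, ‖fderiv ℝ f x‖ ^ 2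
      = ∫ x in ball 0 r, ((R - r) ^ 2) ^ 2 * ‖fderiv ℝ f x‖ ^ 2 := by
        rw [integral_const_mul]; congr 1; rw [hR]; ring
    _ ≤ ∫ x in ball 0 r, φ x ^ 2 * ‖fderiv ℝ f x‖ ^ 2 := by
        refine setIntegral_mono_on ((integrableOn_ball_sq_norm_fderiv hf hr1).const_mul _)
          hint.integrableOn measurableSet_ball fun x hx => ?_
        have := sub_sq_le_paraboloidCutoff (by linarith) hrR hx
        gcongr
    _ ≤ ∫ x in ball 0 1, φ x ^ 2 * ‖fderiv ℝ f x‖ ^ 2 :=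
        setIntegral_mono_set hint.integrableOn (Filter.Eventually.of_forall fun x => by positivity)
          (ball_subset_ball hr1.le).eventuallyLE
    _ ≤ K * ∫ x in ball 0 1, ‖fderiv ℝ φ x‖ ^ 2 := hE φ hφ hφc hφs
    _ ≤ _ := by
        refine mul_le_mul_of_nonneg_left ?_ hK
        calc _ ≤ ∫ x in ball (0 : EuclideanSpace ℝ (Fin n)) 1, (16 : ℝ) := by
              refine integral_mono_of_nonneg (Filter.Eventually.of_forall fun x => by positivity)
                (integrableOn_const measure_ball_lt_top.ne)
                (Filter.Eventually.of_forall fun x => ?_)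
              have := norm_fderiv_paraboloidCutoff_le hR0 hR1.le x
              calc ‖fderiv ℝ φ x‖ ^ 2 ≤ 4 ^ 2 := by gcongr
                _ = 16 := by norm_num
          _ = _ := by rw [setIntegral_const, smul_eq_mul, mul_comm]

theorem poincare_ball (hr1 : r < 1) (hf : ContDiffOn ℝ 1 f (ball 0 1))
    {Z : Set (EuclideanSpace ℝ (Fin n))} (hZm : MeasurableSet Z) (hZ : Z ⊆ ball 0 r)
    (hfZ : ∀ y ∈ Z, f y = 0) :
    volume.real Z * ∫ x in ball 0 r, f x ^ 2 ≤
      4 * 2 ^ n * volume.real (ball (0 : EuclideanSpace ℝ (Fin n)) r) *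
        ∫ x in ball 0 r, ‖fderiv ℝ f x‖ ^ 2 := by
  have hsub : ball (0 : EuclideanSpace ℝ (Fin n)) r ⊆ ball 0 1 := ball_subset_ball hr1.le
  have h := lintegral_poincare (volume : Measure (EuclideanSpace ℝ (Fin n))) isOpen_ball
    (convex_ball 0 r) (fun x hx y hy => by
      have h1 := mem_ball_zero_iff.1 (hsub hx)
      have h2 := mem_ball_zero_iff.1 (hsub hy)
      linarith [norm_sub_le x y]) hZm hZ (hf.mono hsub) hfZ
  have hf2 : IntegrableOn (fun x => f x ^ 2) (ball 0 r) := by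
    simpa using integrableOn_ball_rpow hf hr1 zero_le_two
  have hg2 := integrableOn_ball_sq_norm_fderiv hf hr1
  rw [← ofReal_integral_eq_lintegral_ofReal hf2 (Filter.Eventually.of_forall fun x => sq_nonneg _),
    finrank_euclideanSpace_fin] at h
  have hg : ∫⁻ x in ball 0 r, ‖fderiv ℝ f x‖ₑ ^ 2 =
      ENNReal.ofReal (∫ x in ball 0 r, ‖fderiv ℝ f x‖ ^ 2) := by
    rw [ofReal_integral_eq_lintegral_ofReal hg2 (Filter.Eventually.of_forall fun x => by positivity)]
    refine lintegral_congr fun x => ?_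
    rw [ENNReal.ofReal_pow (norm_nonneg _), ofReal_norm]
  rw [hg] at h
  have h' := ENNReal.toReal_mono (by
    refine ENNReal.mul_ne_top (ENNReal.mul_ne_top ?_ measure_ball_lt_top.ne) ENNReal.ofReal_ne_top
    exact ENNReal.mul_ne_top (by norm_num) (by simp)) h
  rwa [ENNReal.toReal_mul, ENNReal.toReal_mul, ENNReal.toReal_mul, ENNReal.toReal_mul,
    ENNReal.toReal_pow, ENNReal.toReal_ofReal (integral_nonneg fun x => sq_nonneg _),
    ENNReal.toReal_ofReal (integral_nonneg fun x => by positivity)] at h'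

theorem volume_real_ball_eq (hr : 0 < r) :
    volume.real (ball (0 : EuclideanSpace ℝ (Fin n)) r) =
      r ^ n * volume.real (ball (0 : EuclideanSpace ℝ (Fin n)) 1) := by
  rw [Measure.real, Measure.addHaar_ball_of_pos _ _ hr, ENNReal.toReal_mul,
    ENNReal.toReal_ofReal (by positivity), finrank_euclideanSpace_fin, Measure.real]

/-- A set filling a `δ`-fraction of the unit ball fills a `δ / 2`-fraction of it inside a slightly
smaller ball, whose radius depends only on `n` and `δ`. -/
theorem exists_radius_volume_inter_ball (n : ℕ) (hn : 1 ≤ n) {δ : ℝ} (hδ : 0 < δ) :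
    ∃ r : ℝ, 3 / 4 ≤ r ∧ r < 1 ∧ ∀ Z : Set (EuclideanSpace ℝ (Fin n)), Z ⊆ ball 0 1 →
      δ * volume.real (ball (0 : EuclideanSpace ℝ (Fin n)) 1) ≤ volume.real Z →
      δ / 2 * volume.real (ball (0 : EuclideanSpace ℝ (Fin n)) 1) ≤
        volume.real (Z ∩ ball 0 r) := by
  have hn0 : (0 : ℝ) < n := by exact_mod_cast hn
  set s := min (1 / 4) (δ / (2 * n)) with hs
  have hs0 : 0 < s := lt_min (by norm_num) (by positivity)
  have hs4 : s ≤ 1 / 4 := min_le_left _ _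
  have hsn : n * s ≤ δ / 2 := by
    calc n * s ≤ n * (δ / (2 * n)) := by gcongr; exact min_le_right _ _
      _ = δ / 2 := by field_simp
  refine ⟨1 - s, by linarith, by linarith, fun Z hZ hδZ => ?_⟩
  have hpow : 1 - δ / 2 ≤ (1 - s) ^ n := by
    have := one_add_mul_le_pow (a := -s) (by linarith) n
    rw [← sub_eq_add_neg] at this
    linarith
  have hV : 0 ≤ volume.real (ball (0 : EuclideanSpace ℝ (Fin n)) 1) := measureReal_nonneg
  have hdiff : volume.real (ball (0 : EuclideanSpace ℝ (Fin n)) 1 \ ball 0 (1 - s)) =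
      (1 - (1 - s) ^ n) * volume.real (ball (0 : EuclideanSpace ℝ (Fin n)) 1) := by
    rw [measureReal_sdiff (ball_subset_ball (by linarith)) measurableSet_ball
      measure_ball_lt_top.ne, volume_real_ball_eq (r := 1 - s) (by linarith)]
    ring
  have hle : volume.real Z ≤ volume.real (Z ∩ ball 0 (1 - s)) +
      volume.real (ball (0 : EuclideanSpace ℝ (Fin n)) 1 \ ball 0 (1 - s)) := by
    refine (measureReal_mono (fun x hx => ?_) ?_).trans (measureReal_union_le _ _)
    · by_cases h : x ∈ ball 0 (1 - s)
      · exact Or.inl ⟨hx, h⟩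
      · exact Or.inr ⟨hZ hx, h⟩
    · exact measure_ne_top_of_subset
        (Set.union_subset (Set.inter_subset_left.trans hZ) Set.sdiff_subset)
        (measure_ball_lt_top (x := (0 : EuclideanSpace ℝ (Fin n))) (r := 1)).ne
  rw [hdiff] at hle
  nlinarith [mul_le_mul_of_nonneg_right hpow hV]

theorem exists_truncLog_bound (n : ℕ) (hn : 1 ≤ n) {lam : ℝ} (hlam : 0 < lam) {δ : ℝ}
    (hδ : 0 < δ) :
    ∃ C : ℝ, ∀ a : EuclideanSpace ℝ (Fin n) → Matrix (Fin n) (Fin n) ℝ,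
      (∀ i j, Measurable fun x => a x i j) → UniformlyElliptic lam (ball 0 1) a →
      ∀ v : EuclideanSpace ℝ (Fin n) → ℝ, ContDiffOn ℝ 1 v (ball 0 1) →
      IsWeakSubsolution (ball 0 1) a v → (∀ x ∈ ball 0 1, v x < 1) →
      δ * volume.real (ball (0 : EuclideanSpace ℝ (Fin n)) 1) ≤
        volume.real {x ∈ ball (0 : EuclideanSpace ℝ (Fin n)) 1 | v x ≤ 0} →
      ∀ x ∈ ball 0 (1 / 2), truncLog (v x) ≤ C := by
  obtain ⟨r, hr, hr1, hrZ⟩ := exists_radius_volume_inter_ball n hn hδ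
  set V := volume.real (ball (0 : EuclideanSpace ℝ (Fin n)) 1) with hVdef
  have hV : 0 < V := ENNReal.toReal_pos (measure_ball_pos _ _ one_pos).ne' measure_ball_lt_top.ne
  set K := 4 * lam⁻¹ ^ 2 with hKdef
  have hK : 0 ≤ K := by positivity
  set G := K * (16 * V) / ((1 - r) / 2) ^ 4 with hG
  obtain ⟨C, hC⟩ := exists_moser_bound n hn hK (4 * 2 ^ n * G * (2 / δ))
  refine ⟨C, fun a ham hell v hv hsub hv1 hZ => ?_⟩
  have hf := contDiffOn_truncLog_comp hv hv1
  refine hC r hr hr1 _ hf (fun x hx => truncLog_nonneg (hv1 x hx))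
    (fun q hq φ hφ hφc hφs => truncLog_rpow_energy hlam ham hell isOpen_ball hv hsub hv1 hq hφ
      hφc hφs) ?_
  set Z := {x ∈ ball (0 : EuclideanSpace ℝ (Fin n)) 1 | v x ≤ 0} with hZdef
  have hZm : MeasurableSet Z := by
    have : Z = ball 0 1 \ (ball 0 1 ∩ v ⁻¹' Set.Ioi 0) := by
      ext x
      simp [hZdef]
    rw [this]
    exact measurableSet_ball.diff
      (hv.continuousOn.isOpen_inter_preimage isOpen_ball isOpen_Ioi).measurableSet
  have hP := poincare_ball hr1 hf (hZm.inter measurableSet_ball) Set.inter_subset_right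
    fun y hy => truncLog_of_nonpos hy.1.2
  have hgrad := setIntegral_sq_norm_fderiv_le hK hr hr1 hf fun φ hφ hφc hφs =>
    truncLog_energy hlam ham hell isOpen_ball hv hsub hv1 hφ hφc hφs
  set I := ∫ x in ball 0 r, truncLog (v x) ^ 2 with hI
  have hI0 : 0 ≤ I := integral_nonneg fun x => sq_nonneg _
  have hB : volume.real (ball (0 : EuclideanSpace ℝ (Fin n)) r) ≤ V :=
    measureReal_mono (ball_subset_ball hr1.le) measure_ball_lt_top.ne
  have hkey : δ / 2 * V * I ≤ 4 * 2 ^ n * V * G := by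
    refine ((mul_le_mul_of_nonneg_right (hrZ Z (Set.sep_subset _ _) hZ) hI0).trans hP).trans ?_
    gcongr
  have : V * I ≤ V * (4 * 2 ^ n * G * (2 / δ)) := by
    calc V * I = δ / 2 * V * I * (2 / δ) := by field_simp
      _ ≤ 4 * 2 ^ n * V * G * (2 / δ) := by gcongr
      _ = _ := by ring
  exact le_of_mul_le_mul_left this hV

theorem IsWeakSubsolution.const_mul {U : Set (EuclideanSpace ℝ (Fin n))} (hU : IsOpen U)
    {a : EuclideanSpace ℝ (Fin n) → Matrix (Fin n) (Fin n) ℝ} {v : EuclideanSpace ℝ (Fin n) → ℝ}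
    (hv : ContDiffOn ℝ 1 v U) (hsub : IsWeakSubsolution U a v) {c : ℝ} (hc : 0 ≤ c) :
    IsWeakSubsolution U a fun x => c * v x := by
  intro φ hφ hφc hφs hφ0
  have hgrad : ∀ x ∈ U, gradient (fun x => c * v x) x = c • gradient v x := fun x hx => by
    rw [gradient, gradient, fderiv_const_mul
      ((hv.differentiableOn one_ne_zero).differentiableAt (hU.mem_nhds hx)), map_smul]
  have h : ∫ x in U, ∑ i, ∑ j, gradient φ x i * a x i j * gradient (fun x => c * v x) x j =
      c * ∫ x in U, ∑ i, ∑ j, gradient φ x i * a x i j * gradient v x j := by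
    rw [← integral_const_mul]
    refine setIntegral_congr_fun hU.measurableSet fun x hx => ?_
    simp only [hgrad x hx, Finset.mul_sum, PiLp.smul_apply, smul_eq_mul]
    refine Finset.sum_congr rfl fun i _ => Finset.sum_congr rfl fun j _ => by ring
  rw [h]
  exact mul_nonpos_of_nonneg_of_nonpos hc (hsub φ hφ hφc hφs hφ0)

end Oscillation

/-- De Giorgi's oscillation decay: if a subsolution vanishes (in positive part) on at least a
`δ`-fraction of `B₁`, then it separates from its supremum on `B_{1/2}`. -/
theorem oscillation_decay (n : ℕ) (hn : 1 ≤ n) (lam : ℝ) (hlam : lam ∈ Set.Ioc (0 : ℝ) 1)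
    (δ : ℝ) (hδ : 0 < δ) :
    ∃ ε > (0 : ℝ),
      ∀ a : EuclideanSpace ℝ (Fin n) → Matrix (Fin n) (Fin n) ℝ,
        (∀ i j, Measurable fun x => a x i j) →
        UniformlyElliptic lam (ball (0 : EuclideanSpace ℝ (Fin n)) 1) a →
        ∀ v : EuclideanSpace ℝ (Fin n) → ℝ,
          ContDiffOn ℝ 1 v (ball (0 : EuclideanSpace ℝ (Fin n)) 1) →
          IsWeakSubsolution (ball (0 : EuclideanSpace ℝ (Fin n)) 1) a v →
          BddAbove (v '' ball (0 : EuclideanSpace ℝ (Fin n)) 1) →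
          δ * (volume (ball (0 : EuclideanSpace ℝ (Fin n)) 1)).toReal ≤
            (volume {x ∈ ball (0 : EuclideanSpace ℝ (Fin n)) 1 | max (v x) 0 = 0}).toReal →
          ∀ x ∈ ball (0 : EuclideanSpace ℝ (Fin n)) (1 / 2),
            v x ≤ (1 - ε) *
              sSup ((fun y => max (v y) 0) '' ball (0 : EuclideanSpace ℝ (Fin n)) 1) := by
  obtain ⟨C, hC⟩ := exists_truncLog_bound n hn hlam.1 hδ
  refine ⟨Real.exp (-C) / 3, by positivity, fun a ham hell v hv hsub hbdd hZ x hx => ?_⟩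
  set M := sSup ((fun y => max (v y) 0) '' ball (0 : EuclideanSpace ℝ (Fin n)) 1) with hM
  have hbdd' : BddAbove ((fun y => max (v y) 0) '' ball (0 : EuclideanSpace ℝ (Fin n)) 1) := by
    obtain ⟨b, hb⟩ := hbdd
    refine ⟨max b 0, ?_⟩
    rintro _ ⟨y, hy, rfl⟩
    exact max_le_max_right 0 (hb ⟨y, hy, rfl⟩)
  have hvM : ∀ y ∈ ball (0 : EuclideanSpace ℝ (Fin n)) 1, max (v y) 0 ≤ M := fun y hy =>
    le_csSup hbdd' ⟨y, hy, rfl⟩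
  have hM0 : 0 ≤ M := (le_max_right _ _).trans (hvM 0 (mem_ball_self one_pos))
  have key : ∀ η > 0, v x ≤ (1 - Real.exp (-C) / 3) * (M + η) := fun η hη => by
    have hMη : 0 < M + η := by linarith
    have hc : 0 < (M + η)⁻¹ := inv_pos.2 hMη
    have hv1 : ∀ y ∈ ball 0 1, (M + η)⁻¹ * v y < 1 := fun y hy => by
      rw [inv_mul_lt_iff₀ hMη, mul_one]
      linarith [(le_max_left _ _).trans (hvM y hy)]
    have h := le_of_truncLog_le (hv1 x (ball_subset_ball (by norm_num) hx))
      (hC a ham hell (fun y => (M + η)⁻¹ * v y) (contDiffOn_const.mul hv)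
        (hsub.const_mul isOpen_ball hv hc.le) hv1 (by
          refine hZ.trans (le_of_eq ?_)
          simp only [max_eq_right_iff, Measure.real]
          congr! 5 with y
          exact ⟨fun h => mul_nonpos_of_nonneg_of_nonpos hc.le h,
            fun h => nonpos_of_mul_nonpos_right h hc⟩) x hx)
    rwa [inv_mul_le_iff₀ hMη, mul_comm] at h
  have hlim : Filter.Tendsto (fun η : ℝ => (1 - Real.exp (-C) / 3) * (M + η))
      (nhdsWithin 0 (Set.Ioi 0)) (nhds ((1 - Real.exp (-C) / 3) * (M + 0))) :=
    (Continuous.tendsto (by fun_prop) 0).mono_left nhdsWithin_le_nhds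
  rw [add_zero] at hlim
  exact ge_of_tendsto hlim (Filter.eventually_of_mem self_mem_nhdsWithin key)
end
end

section
/- (Courant–Lebesgue lemma) Let w be a C¹ function on the ball B₁ ⊂ ℝ² such that the function s ↦ osc_{∂B_s} w is non-decreasing for s ∈ (0, 1/2]. Then for every r ∈ (0, 1/2), (osc_{∂B_r} w)² ≤ (π / log(1/(2r))) · ∫_{B_{1/2}} |∇w|² dx. -/
open MeasureTheory Metric Real

noncomputable section

/-- The oscillation of `w` over a set `S`: `sup_S w - inf_S w`. -/
def osc {n : ℕ} (w : EuclideanSpace ℝ (Fin n) → ℝ) (S : Set (EuclideanSpace ℝ (Fin n))) : ℝ :=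
  sSup (w '' S) - sInf (w '' S)

/-- A `2π`-periodic Cauchy–Schwarz bound along an arc of length at most `π`. -/
theorem sq_sub_le_pi_mul_integral {g g' K : ℝ → ℝ} (hg : ∀ t, HasDerivAt g (g' t) t)
    (hg' : Continuous g') (hK : Continuous K) (hle : ∀ t, g' t ^ 2 ≤ K t)
    (hper : Function.Periodic K (2 * π)) {a b : ℝ} (hab : |b - a| ≤ π) :
    (g b - g a) ^ 2 ≤ π * ∫ t in (-π)..π, K t := by
  wlog h : a ≤ b generalizing a b
  · have := this (a := b) (b := a) (by rwa [abs_sub_comm]) (le_of_not_ge h)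
    rwa [← neg_sub, neg_sq]
  have hlen : b - a ≤ π := (le_abs_self _).trans hab
  have hKnn : ∀ t, 0 ≤ K t := fun t => (sq_nonneg _).trans (hle t)
  have hI : ∫ t in a..b, K t ≤ ∫ t in (-π)..π, K t := by
    have h1 := hper.intervalIntegral_add_eq a (-π)
    rw [show -π + 2 * π = π by ring] at h1
    rw [← h1]
    exact intervalIntegral.integral_mono_interval le_rfl h (by linarith [pi_pos])
      (Filter.Eventually.of_forall hKnn) (hK.intervalIntegrable _ _)
  have hftc : ∫ t in a..b, g' t = g b - g a :=
    intervalIntegral.integral_eq_sub_of_hasDerivAt (fun t _ => hg t) (hg'.intervalIntegrable _ _)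
  have hlower : ∀ c : ℝ, 2 * c * (g b - g a) - c ^ 2 * (b - a) ≤ ∫ t in a..b, K t := by
    intro c
    have h2 : ∫ t in a..b, (2 * c * g' t - c ^ 2) ≤ ∫ t in a..b, K t := by
      refine intervalIntegral.integral_mono_on h (Continuous.intervalIntegrable (by fun_prop) _ _)
        (hK.intervalIntegrable _ _) fun t _ => ?_
      nlinarith [hle t, sq_nonneg (g' t - c)]
    rw [intervalIntegral.integral_sub (Continuous.intervalIntegrable (by fun_prop) _ _)
      (by simp), intervalIntegral.integral_const_mul, hftc] at h2
    simp only [intervalIntegral.integral_const, smul_eq_mul] at h2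
    linarith
  have h3 := hlower ((g b - g a) / π)
  have h4 : ((g b - g a) / π) ^ 2 * (b - a) ≤ ((g b - g a) / π) ^ 2 * π :=
    mul_le_mul_of_nonneg_left hlen (sq_nonneg _)
  have h5 : (g b - g a) ^ 2 / π ≤ ∫ t in (-π)..π, K t := by
    have : (g b - g a) ^ 2 / π =
        2 * ((g b - g a) / π) * (g b - g a) - ((g b - g a) / π) ^ 2 * π := by
      field_simp
      ring
    linarith
  rwa [div_le_iff₀' pi_pos] at h5

/-- The parametrization of the Euclidean plane by polar coordinates. -/
def polarMap (p : ℝ × ℝ) : EuclideanSpace ℝ (Fin 2) :=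
  Complex.orthonormalBasisOneI.repr (p.1 * Complex.exp (p.2 * Complex.I))

theorem continuous_polarMap : Continuous polarMap := by
  unfold polarMap
  exact Complex.orthonormalBasisOneI.repr.continuous.comp (by fun_prop)

theorem norm_polarMap (p : ℝ × ℝ) : ‖polarMap p‖ = |p.1| := by
  rw [polarMap, LinearIsometryEquiv.norm_map, norm_mul, Complex.norm_exp_ofReal_mul_I]
  simp

theorem polarMap_add_two_pi (s t : ℝ) : polarMap (s, t + 2 * π) = polarMap (s, t) := by
  simp only [polarMap]
  congr 2
  push_cast
  rw [add_mul, Complex.exp_periodic]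

theorem hasDerivAt_polarMap (s t : ℝ) :
    HasDerivAt (fun u : ℝ => polarMap (s, u))
      (Complex.orthonormalBasisOneI.repr (s * (Complex.exp (t * Complex.I) * Complex.I))) t := by
  have h : HasDerivAt (fun u : ℝ => (s : ℂ) * Complex.exp (u * Complex.I))
      (s * (Complex.exp (t * Complex.I) * Complex.I)) t := by
    have h1 : HasDerivAt (fun u : ℝ => (u : ℂ) * Complex.I) Complex.I t := by
      simpa using (Complex.ofRealCLM.hasDerivAt (x := t)).mul_const Complex.I
    exact h1.cexp.const_mul _
  exact Complex.orthonormalBasisOneI.repr.toContinuousLinearEquiv.hasFDerivAt.comp_hasDerivAt t h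

theorem exists_polarMap_eq_of_mem_sphere {s : ℝ} (hs : 0 < s) {x y : EuclideanSpace ℝ (Fin 2)}
    (hx : x ∈ sphere 0 s) (hy : y ∈ sphere 0 s) :
    ∃ a b : ℝ, |b - a| ≤ π ∧ polarMap (s, a) = x ∧ polarMap (s, b) = y := by
  rw [mem_sphere_zero_iff_norm] at hx hy
  set e := Complex.orthonormalBasisOneI.repr
  have hx' : ‖e.symm x‖ = s := by rw [LinearIsometryEquiv.norm_map, hx]
  have hy' : ‖e.symm y‖ = s := by rw [LinearIsometryEquiv.norm_map, hy]
  have hx0 : e.symm x ≠ 0 := norm_pos_iff.1 (hx' ▸ hs)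
  have h1 : (s : ℂ) * Complex.exp ((e.symm x).arg * Complex.I) = e.symm x := by
    rw [← hx', Complex.norm_mul_exp_arg_mul_I]
  have h2 : Complex.exp ((e.symm y / e.symm x).arg * Complex.I) = e.symm y / e.symm x := by
    have := Complex.norm_mul_exp_arg_mul_I (e.symm y / e.symm x)
    rwa [norm_div, hx', hy', div_self hs.ne', Complex.ofReal_one, one_mul] at this
  refine ⟨(e.symm x).arg, (e.symm x).arg + (e.symm y / e.symm x).arg, ?_, ?_, ?_⟩
  · rw [add_sub_cancel_left]
    exact Complex.abs_arg_le_pi _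
  · change e _ = x
    rw [h1, e.apply_symm_apply]
  · change e _ = y
    push_cast
    rw [add_mul, Complex.exp_add, ← mul_assoc, h1, h2, mul_div_cancel₀ _ hx0, e.apply_symm_apply]

theorem norm_gradient_eq_s6 (w : EuclideanSpace ℝ (Fin 2) → ℝ) (x : EuclideanSpace ℝ (Fin 2)) :
    ‖gradient w x‖ = ‖fderiv ℝ w x‖ := by
  simp [gradient]

theorem continuousOn_norm_gradient_sq {w : EuclideanSpace ℝ (Fin 2) → ℝ}
    (hw : ContDiffOn ℝ 1 w (ball (0 : EuclideanSpace ℝ (Fin 2)) 1)) :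
    ContinuousOn (fun x => ‖gradient w x‖ ^ 2) (ball (0 : EuclideanSpace ℝ (Fin 2)) 1) := by
  simp only [norm_gradient_eq_s6]
  exact ((hw.continuousOn_fderiv_of_isOpen isOpen_ball le_rfl).norm.pow 2)

theorem osc_sphere_sq_le {w : EuclideanSpace ℝ (Fin 2) → ℝ}
    (hw : ContDiffOn ℝ 1 w (ball (0 : EuclideanSpace ℝ (Fin 2)) 1)) {s : ℝ} (hs : 0 < s)
    (hs1 : s < 1) :
    osc w (sphere (0 : EuclideanSpace ℝ (Fin 2)) s) ^ 2 ≤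
      π * ∫ t in (-π)..π, s ^ 2 * ‖gradient w (polarMap (s, t))‖ ^ 2 := by
  have hmem : ∀ t, polarMap (s, t) ∈ ball (0 : EuclideanSpace ℝ (Fin 2)) 1 := fun t => by
    rwa [mem_ball_zero_iff, norm_polarMap, abs_of_pos hs]
  have hcurve : Continuous fun t => polarMap (s, t) := continuous_polarMap.comp (by fun_prop)
  have hcont : ContinuousOn w (sphere 0 s) :=
    hw.continuousOn.mono fun x hx => by
      rw [mem_sphere_zero_iff_norm] at hx
      rwa [mem_ball_zero_iff, hx]
  have hne : (sphere (0 : EuclideanSpace ℝ (Fin 2)) s).Nonempty :=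
    NormedSpace.sphere_nonempty.2 hs.le
  obtain ⟨x, hx, hxs, -⟩ := (isCompact_sphere 0 s).exists_sSup_image_eq_and_ge hne hcont
  obtain ⟨y, hy, hys, -⟩ := (isCompact_sphere 0 s).exists_sInf_image_eq_and_le hne hcont
  obtain ⟨a, b, hab, rfl, rfl⟩ := exists_polarMap_eq_of_mem_sphere hs hy hx
  rw [osc, hxs, hys]
  refine sq_sub_le_pi_mul_integral (g := fun t => w (polarMap (s, t)))
    (g' := fun t => fderiv ℝ w (polarMap (s, t))
      (Complex.orthonormalBasisOneI.repr (s * (Complex.exp (t * Complex.I) * Complex.I))))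
    (fun t => ?_) ?_ ?_ (fun t => ?_) (fun t => ?_) hab
  · exact ((hw.differentiableOn one_ne_zero).differentiableAt
      (isOpen_ball.mem_nhds (hmem t))).hasFDerivAt.comp_hasDerivAt t (hasDerivAt_polarMap s t)
  · exact ((hw.continuousOn_fderiv_of_isOpen isOpen_ball le_rfl).comp_continuous
      hcurve hmem).clm_apply (Complex.orthonormalBasisOneI.repr.continuous.comp (by fun_prop))
  · exact continuous_const.mul
      ((continuousOn_norm_gradient_sq hw).comp_continuous hcurve hmem)
  · have h := (fderiv ℝ w (polarMap (s, t))).le_opNorm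
      (Complex.orthonormalBasisOneI.repr (s * (Complex.exp (t * Complex.I) * Complex.I)))
    rw [LinearIsometryEquiv.norm_map, norm_mul, norm_mul, Complex.norm_exp_ofReal_mul_I,
      Complex.norm_I, Complex.norm_real, norm_of_nonneg hs.le, mul_one, mul_one] at h
    rw [norm_gradient_eq_s6, ← mul_pow, mul_comm s, ← sq_abs]
    gcongr
    exact h
  · simp only [polarMap_add_two_pi]

theorem integral_ball_eq_integral_polarMap (f : EuclideanSpace ℝ (Fin 2) → ℝ) (R : ℝ) :
    ∫ x in ball (0 : EuclideanSpace ℝ (Fin 2)) R, f x =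
      ∫ p in Set.Ioo 0 R ×ˢ Set.Ioo (-π) π, p.1 * f (polarMap p) := by
  rw [← integral_indicator measurableSet_ball,
    ← (LinearIsometryEquiv.measurePreserving Complex.orthonormalBasisOneI.repr).integral_comp
      Complex.orthonormalBasisOneI.repr.toHomeomorph.measurableEmbedding,
    ← Complex.integral_comp_polarCoord_symm, ← integral_indicator (by measurability),
    ← integral_indicator (by measurability)]
  congr 1 with p
  have hp : Complex.orthonormalBasisOneI.repr (Complex.polarCoord.symm p) = polarMap p := by
    rw [Complex.polarCoord_symm_apply, polarMap, Complex.exp_mul_I, Complex.ofReal_cos,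
      Complex.ofReal_sin]
  simp only [Set.indicator, hp, mem_ball_zero_iff, norm_polarMap, polarCoord_target,
    Set.mem_prod, Set.mem_Ioi, Set.mem_Ioo, smul_eq_mul]
  by_cases h0 : 0 < p.1 <;> by_cases h1 : p.1 < R <;> simp [h0, h1, abs_of_pos]

/-- Courant–Lebesgue lemma in the plane: if the oscillation of `w` over circles `∂B_s` is
non-decreasing for `s ∈ (0, 1/2]`, then the oscillation over `∂B_r` is controlled by the
Dirichlet energy of `w` in `B_{1/2}`. -/
theorem courant_lebesgue (w : EuclideanSpace ℝ (Fin 2) → ℝ)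
    (hw : ContDiffOn ℝ 1 w (ball (0 : EuclideanSpace ℝ (Fin 2)) 1))
    (hmono : ∀ s t : ℝ, 0 < s → s ≤ t → t ≤ 1 / 2 →
      osc w (sphere (0 : EuclideanSpace ℝ (Fin 2)) s) ≤
        osc w (sphere (0 : EuclideanSpace ℝ (Fin 2)) t))
    (r : ℝ) (hr : r ∈ Set.Ioo (0 : ℝ) (1 / 2)) :
    osc w (sphere (0 : EuclideanSpace ℝ (Fin 2)) r) ^ 2 ≤
      (π / Real.log (1 / (2 * r))) *
        ∫ x in ball (0 : EuclideanSpace ℝ (Fin 2)) (1 / 2), ‖gradient w x‖ ^ 2 := by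
  obtain ⟨hr0, hr1⟩ := hr
  set G : EuclideanSpace ℝ (Fin 2) → ℝ := fun x => ‖gradient w x‖ ^ 2 with hG
  set M := osc w (sphere (0 : EuclideanSpace ℝ (Fin 2)) r) with hM
  have hM0 : 0 ≤ M := by
    have hb : Bornology.IsBounded (w '' sphere (0 : EuclideanSpace ℝ (Fin 2)) r) :=
      ((isCompact_sphere 0 r).image_of_continuousOn (hw.continuousOn.mono
        (sphere_subset_closedBall.trans (closedBall_subset_ball (by linarith))))).isBounded
    exact sub_nonneg.2 (Real.sInf_le_sSup _ hb.bddBelow hb.bddAbove)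
  have hint : IntegrableOn (fun p : ℝ × ℝ => p.1 * G (polarMap p))
      (Set.Ioo 0 (1 / 2) ×ˢ Set.Ioo (-π) π) := by
    refine IntegrableOn.mono_set (t := Set.Icc 0 (1 / 2) ×ˢ Set.Icc (-π) π) ?_
      (Set.prod_mono Set.Ioo_subset_Icc_self Set.Ioo_subset_Icc_self)
    refine ContinuousOn.integrableOn_compact (isCompact_Icc.prod isCompact_Icc) ?_
    refine continuous_fst.continuousOn.mul ((continuousOn_norm_gradient_sq hw).comp
      continuous_polarMap.continuousOn fun p hp => ?_)
    rw [mem_ball_zero_iff, norm_polarMap, abs_of_nonneg hp.1.1]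
    linarith [hp.1.2]
  have hsub : Set.Ioo r (1 / 2) ×ˢ Set.Ioo (-π) π ⊆ Set.Ioo 0 (1 / 2) ×ˢ Set.Ioo (-π) π :=
    Set.prod_mono (Set.Ioo_subset_Ioo_left hr0.le) le_rfl
  have hannulus : ∫ s in Set.Ioo r (1 / 2), ∫ t in Set.Ioo (-π) π, s * G (polarMap (s, t)) ≤
      ∫ x in ball (0 : EuclideanSpace ℝ (Fin 2)) (1 / 2), G x := by
    rw [integral_ball_eq_integral_polarMap, ← setIntegral_prod
      (fun p : ℝ × ℝ => p.1 * G (polarMap p)) (hint.mono_set hsub)]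
    refine setIntegral_mono_set hint ?_ hsub.eventuallyLE
    filter_upwards [ae_restrict_mem (by measurability)] with p hp
    exact mul_nonneg hp.1.1.le (sq_nonneg _)
  have hcircle : ∀ s ∈ Set.Ioo r (1 / 2), M ^ 2 / π * s⁻¹ ≤
      ∫ t in Set.Ioo (-π) π, s * G (polarMap (s, t)) := by
    rintro s ⟨hs, hs'⟩
    have hs0 : 0 < s := hr0.trans hs
    have h1 := osc_sphere_sq_le hw hs0 (by linarith)
    have h2 : M ^ 2 ≤ osc w (sphere (0 : EuclideanSpace ℝ (Fin 2)) s) ^ 2 :=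
      pow_le_pow_left₀ hM0 (hmono r s hr0 hs.le hs'.le) 2
    rw [intervalIntegral.integral_of_le (by linarith [pi_pos]), integral_Ioc_eq_integral_Ioo,
      integral_const_mul] at h1
    rw [integral_const_mul]
    have h3 := h2.trans h1
    rw [← div_eq_mul_inv, div_div, div_le_iff₀ (by positivity)]
    linarith
  have hlog : ∫ s in Set.Ioo r (1 / 2), M ^ 2 / π * s⁻¹ = M ^ 2 / π * Real.log (1 / (2 * r)) := by
    rw [integral_const_mul, ← integral_Ioc_eq_integral_Ioo,
      ← intervalIntegral.integral_of_le hr1.le, integral_inv_of_pos hr0 (by norm_num), div_div]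
  have hinv : IntegrableOn (fun s : ℝ => M ^ 2 / π * s⁻¹) (Set.Ioo r (1 / 2)) := by
    refine IntegrableOn.mono_set (t := Set.Icc r (1 / 2)) ?_ Set.Ioo_subset_Icc_self
    exact ContinuousOn.integrableOn_compact isCompact_Icc (continuousOn_const.mul
      (continuousOn_id.inv₀ fun s hs => (hr0.trans_le hs.1).ne'))
  have hprod : IntegrableOn (fun s => ∫ t in Set.Ioo (-π) π, s * G (polarMap (s, t)))
      (Set.Ioo r (1 / 2)) := by
    have h := hint.mono_set hsub
    rw [IntegrableOn, Measure.volume_eq_prod, ← Measure.prod_restrict] at h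
    exact h.integral_prod_left
  have hmain : M ^ 2 / π * Real.log (1 / (2 * r)) ≤
      ∫ x in ball (0 : EuclideanSpace ℝ (Fin 2)) (1 / 2), G x :=
    hlog ▸ (setIntegral_mono_on hinv hprod measurableSet_Ioo hcircle).trans hannulus
  have hlogpos : 0 < Real.log (1 / (2 * r)) :=
    Real.log_pos (by rw [lt_div_iff₀ (by positivity)]; linarith)
  rw [div_mul_eq_mul_div, le_div_iff₀ hlogpos]
  rw [div_mul_eq_mul_div, div_le_iff₀' pi_pos] at hmain
  exact hmain
end
end
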